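/- arXiv:0808.2686 — 2 statements merged into one kernel-verified Lean document; each statement's English description precedes it below -/
import Mathlib

section
/- If G is an orderable group whose center Z(G) contains an isolated infinite cyclic subgroup ⟨z⟩, then G admits a discrete two-sided order with z as the minimal positive element. -/
variable {G : Type*} [Group G]

/-- A right order on a group: a strict total order invariant under right multiplication. -/
def IsRightOrder (r : G → G → Prop) : Prop :=
  IsStrictTotalOrder G r ∧ ∀ f g h : G, r f g → r (f * h) (g * h)

/-- `a` is the least element greater than the identity for the order `r`. -/
def LeastPos (r : G → G → Prop) (a : G) : Prop :=
  r 1 a ∧ ∀ g : G, r 1 g → g = a ∨ r a g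

set_option linter.unusedSectionVars false

section Aux

variable {K : Type*} [Group K] [LinearOrder K] [MulLeftMono K] [MulRightMono K]
  [MulLeftStrictMono K] [MulRightStrictMono K]

theorem aux_powmul (g h : K) (hc : g * h ≤ h * g) (n : ℕ) : g ^ n * h ^ n ≤ (g * h) ^ n := by
  induction n with
  | zero => simp
  | succ n ih =>
    have e : ∀ n : ℕ, (g * h) ^ (n + 1) = g * (h * g) ^ n * h := by
      intro n
      induction n with
      | zero => simp
      | succ m ihm =>
        rw [pow_succ, ihm, pow_succ (h * g)]
        simp only [mul_assoc]
    rw [e, pow_succ' g, pow_succ h]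
    calc g * g ^ n * (h ^ n * h) = g * (g ^ n * h ^ n) * h := by simp only [mul_assoc]
      _ ≤ g * (h * g) ^ n * h := by
        apply mul_le_mul_left
        apply mul_le_mul_right
        exact ih.trans (pow_le_pow_left' hc n)

theorem aux_powmul_or (g h : K) (n : ℕ) :
    g ^ n * h ^ n ≤ (g * h) ^ n ∨ h ^ n * g ^ n ≤ (g * h) ^ n := by
  rcases le_total (g * h) (h * g) with hc | hc
  · exact Or.inl (aux_powmul g h hc n)
  · exact Or.inr ((aux_powmul h g hc n).trans (pow_le_pow_left' hc n))

theorem aux_zmono {z : K} (hz : 1 < z) : StrictMono fun n : ℤ => z ^ n := by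
  refine strictMono_int_of_lt_succ fun n => ?_
  rw [zpow_add_one]
  exact lt_mul_of_one_lt_right' (z ^ n) hz

theorem aux_sup_le {z g h : K} {k l : ℤ} {n : ℕ}
    (h1 : z ^ k ≤ g ^ n) (h2 : z ^ l ≤ h ^ n) : z ^ (k + l) ≤ (g * h) ^ n := by
  rcases aux_powmul_or g h n with hh | hh
  · rw [zpow_add]; exact (mul_le_mul' h1 h2).trans hh
  · rw [add_comm, zpow_add]; exact (mul_le_mul' h2 h1).trans hh

theorem aux_sup_lt {z g h : K} {k l : ℤ} {n : ℕ}
    (h1 : z ^ k < g ^ n) (h2 : z ^ l < h ^ n) : z ^ (k + l) < (g * h) ^ n := by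
  rcases aux_powmul_or g h n with hh | hh
  · rw [zpow_add]; exact (mul_lt_mul_of_lt_of_lt h1 h2).trans_le hh
  · rw [add_comm, zpow_add]; exact (mul_lt_mul_of_lt_of_lt h2 h1).trans_le hh

theorem aux_raise_le {z g : K} {k : ℤ} {n : ℕ} (h1 : z ^ k ≤ g ^ n) (m : ℕ) :
    z ^ (k * m) ≤ g ^ (n * m) := by
  rw [zpow_mul, pow_mul, zpow_natCast]; exact pow_le_pow_left' h1 m

theorem aux_raise_ge {z g : K} {k : ℤ} {n : ℕ} (h1 : g ^ n ≤ z ^ k) (m : ℕ) :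
    g ^ (n * m) ≤ z ^ (k * m) := by
  rw [zpow_mul, pow_mul, zpow_natCast]; exact pow_le_pow_left' h1 m

theorem aux_raise_lt {z g : K} {k : ℤ} {n : ℕ} (h1 : z ^ k < g ^ n) {m : ℕ} (hm : 0 < m) :
    z ^ (k * m) < g ^ (n * m) := by
  rw [zpow_mul, pow_mul, zpow_natCast]; exact pow_left_strictMono hm.ne' h1

/-- The convex subgroup generated by `z`. -/
def auxD (z g : K) : Prop := ∃ a b : ℤ, z ^ a ≤ g ∧ g ≤ z ^ b

/-- The set whose supremum is the translation number. -/
def auxS (z g : K) : Set ℝ :=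
  {x | ∃ (k : ℤ) (n : ℕ), 0 < n ∧ z ^ k ≤ g ^ n ∧ x = (k : ℝ) / n}

/-- The translation number of `g` with respect to `z`. -/
noncomputable def auxT (z g : K) : ℝ := sSup (auxS z g)

theorem auxS_bd {z g : K} (hz : 1 < z) {k : ℤ} {n : ℕ} (hn : 0 < n) (h : g ^ n ≤ z ^ k) :
    ∀ x ∈ auxS z g, x ≤ (k : ℝ) / n := by
  rintro x ⟨l, m, hm, hl, rfl⟩
  have h1 := aux_raise_le hl n
  have h2 := aux_raise_ge h m
  rw [mul_comm n m] at h2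
  have h3 := (aux_zmono hz).le_iff_le.1 (h1.trans h2)
  have hm' : (0 : ℝ) < m := by exact_mod_cast hm
  have hn' : (0 : ℝ) < n := by exact_mod_cast hn
  rw [div_le_div_iff₀ hm' hn']
  exact_mod_cast h3

theorem auxS_ne {z g : K} (hD : auxD z g) : (auxS z g).Nonempty := by
  obtain ⟨a, b, ha, hb⟩ := hD
  exact ⟨_, a, 1, one_pos, by simpa using ha, rfl⟩

theorem auxS_bdd {z g : K} (hz : 1 < z) (hD : auxD z g) : BddAbove (auxS z g) := by
  obtain ⟨a, b, ha, hb⟩ := hD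
  exact ⟨_, fun x hx => auxS_bd hz (n := 1) (k := b) one_pos (by simpa using hb) x hx⟩

theorem auxT_ge {z g : K} (hz : 1 < z) (hD : auxD z g) {k : ℤ} {n : ℕ} (hn : 0 < n)
    (h : z ^ k ≤ g ^ n) : (k : ℝ) / n ≤ auxT z g :=
  le_csSup (auxS_bdd hz hD) ⟨k, n, hn, h, rfl⟩

theorem auxT_le {z g : K} (hz : 1 < z) (hD : auxD z g) {k : ℤ} {n : ℕ} (hn : 0 < n)
    (h : g ^ n ≤ z ^ k) : auxT z g ≤ (k : ℝ) / n :=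
  csSup_le (auxS_ne hD) (auxS_bd hz hn h)

theorem auxD_zpow (z : K) (m : ℤ) : auxD z (z ^ m) := ⟨m, m, le_rfl, le_rfl⟩

theorem auxD_mul {z g h : K} (hg : auxD z g) (hh : auxD z h) : auxD z (g * h) := by
  obtain ⟨a, b, h1, h2⟩ := hg
  obtain ⟨c, d, h3, h4⟩ := hh
  refine ⟨a + c, b + d, ?_, ?_⟩ <;> rw [zpow_add]
  · exact mul_le_mul' h1 h3
  · exact mul_le_mul' h2 h4

theorem auxD_inv {z g : K} (hg : auxD z g) : auxD z g⁻¹ := by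
  obtain ⟨a, b, h1, h2⟩ := hg
  refine ⟨-b, -a, ?_, ?_⟩ <;> rw [zpow_neg]
  · exact inv_le_inv_iff.2 h2
  · exact inv_le_inv_iff.2 h1

theorem auxT_zpow {z : K} (hz : 1 < z) (m : ℤ) : auxT z (z ^ m) = m := by
  apply le_antisymm
  · simpa using auxT_le hz (auxD_zpow z m) (k := m) (n := 1) one_pos (by simp)
  · simpa using auxT_ge hz (auxD_zpow z m) (k := m) (n := 1) one_pos (by simp)

theorem auxT_sup {z g h : K} (hz : 1 < z) (hg : auxD z g) (hh : auxD z h) :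
    auxT z g + auxT z h ≤ auxT z (g * h) := by
  have key : ∀ x ∈ auxS z g, ∀ y ∈ auxS z h, x + y ≤ auxT z (g * h) := by
    rintro x ⟨k, n, hn, h1, rfl⟩ y ⟨l, m, hm, h2, rfl⟩
    have h3 := aux_raise_le h1 m
    have h4 := aux_raise_le h2 n
    rw [mul_comm m n] at h4
    have h5 := auxT_ge hz (auxD_mul hg hh) (Nat.mul_pos hn hm) (aux_sup_le h3 h4)
    have hm' : (0 : ℝ) < m := by exact_mod_cast hm
    have hn' : (0 : ℝ) < n := by exact_mod_cast hn
    convert h5 using 1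
    push_cast
    field_simp
  have k2 : ∀ y ∈ auxS z h, y ≤ auxT z (g * h) - auxT z g := by
    intro y hy
    have : auxT z g ≤ auxT z (g * h) - y :=
      csSup_le (auxS_ne hg) fun x hx => by linarith [key x hx y hy]
    linarith
  have : auxT z h ≤ auxT z (g * h) - auxT z g := csSup_le (auxS_ne hh) k2
  linarith

theorem auxT_inv {z g : K} (hz : 1 < z) (hg : auxD z g) : auxT z g⁻¹ = - auxT z g := by
  have h0 : auxT z (1 : K) = 0 := by simpa using auxT_zpow hz 0
  have h1 := auxT_sup hz hg (auxD_inv hg)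
  rw [mul_inv_cancel, h0] at h1
  by_contra hne
  have h2 : auxT z g < - auxT z g⁻¹ := by
    rcases lt_or_eq_of_le h1 with h | h
    · linarith
    · exact absurd (by linarith) hne
  obtain ⟨q, hq1, hq2⟩ := exists_rat_btwn h2
  have hqc : (q : ℝ) = (q.num : ℝ) / (q.den : ℝ) := by exact_mod_cast (Rat.num_div_den q).symm
  rcases le_total (z ^ q.num) (g ^ q.den) with h | h
  · have := auxT_ge hz hg q.den_pos h
    rw [← hqc] at this
    linarith
  · have h' : z ^ (-q.num) ≤ g⁻¹ ^ q.den := by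
      rw [zpow_neg, inv_pow]; exact inv_le_inv_iff.2 h
    have := auxT_ge hz (auxD_inv hg) q.den_pos h'
    push_cast at this
    rw [neg_div, ← hqc] at this
    linarith

theorem auxT_mul {z g h : K} (hz : 1 < z) (hg : auxD z g) (hh : auxD z h) :
    auxT z (g * h) = auxT z g + auxT z h := by
  have h1 := auxT_sup hz hg hh
  have h2 := auxT_sup hz (auxD_mul hg hh) (auxD_inv hh)
  rw [auxT_inv hz hh, mul_inv_cancel_right] at h2
  linarith

theorem aux_conj_le {z : K} (hzc : ∀ x : K, Commute z x) (h g : K) (k : ℤ) :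
    z ^ k ≤ h * g * h⁻¹ ↔ z ^ k ≤ g := by
  have e : z ^ k = h * z ^ k * h⁻¹ := by
    rw [((hzc h).zpow_left k).symm.eq, mul_inv_cancel_right]
  conv_lhs => rw [e]
  rw [mul_le_mul_iff_right, mul_le_mul_iff_left]

theorem aux_conj_ge {z : K} (hzc : ∀ x : K, Commute z x) (h g : K) (k : ℤ) :
    h * g * h⁻¹ ≤ z ^ k ↔ g ≤ z ^ k := by
  have e : z ^ k = h * z ^ k * h⁻¹ := by
    rw [((hzc h).zpow_left k).symm.eq, mul_inv_cancel_right]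
  conv_lhs => rw [e]
  rw [mul_le_mul_iff_right, mul_le_mul_iff_left]

theorem auxT_conj {z : K} (hzc : ∀ x : K, Commute z x) (h g : K) :
    auxT z (h * g * h⁻¹) = auxT z g := by
  unfold auxT auxS
  simp only [conj_pow, aux_conj_le hzc]

theorem auxD_conj {z : K} (hzc : ∀ x : K, Commute z x) (h g : K) :
    auxD z (h * g * h⁻¹) ↔ auxD z g := by
  unfold auxD
  simp only [aux_conj_le hzc, aux_conj_ge hzc]

theorem aux_proj : ∃ f : ℝ →ₗ[ℚ] ℝ, ∀ x, f x = 0 ↔ ∃ q : ℚ, (q : ℝ) = x := by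
  obtain ⟨W, hW⟩ := Submodule.exists_isCompl (Submodule.span ℚ {(1 : ℝ)})
  refine ⟨Submodule.projection W _ hW.symm, fun x => ?_⟩
  rw [Submodule.projection_apply_eq_zero_iff, Submodule.mem_span_singleton]
  simp [Rat.smul_def]

/-- The positive cone. -/
def auxP (f : ℝ →ₗ[ℚ] ℝ) (z g : K) : Prop :=
  (∀ m : ℤ, z ^ m < g) ∨ (auxD z g ∧ 0 < f (auxT z g)) ∨
  (auxD z g ∧ ∃ (k : ℤ) (n : ℕ), 0 < n ∧ auxT z g = (k : ℝ) / n ∧ z ^ k < g ^ n) ∨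
  (∃ m : ℤ, 0 < m ∧ g = z ^ m)

theorem auxP_cone {z : K} (hz : 1 < z) (hzc : ∀ x : K, Commute z x)
    (hiso : ∀ (g : K) (n : ℕ), 0 < n → (∃ k : ℤ, g ^ n = z ^ k) → ∃ m : ℤ, g = z ^ m)
    (f : ℝ →ₗ[ℚ] ℝ) (hf : ∀ x, f x = 0 ↔ ∃ q : ℚ, (q : ℝ) = x) :
    ¬ auxP f z (1 : K) ∧ (∀ g h : K, auxP f z g → auxP f z h → auxP f z (g * h)) ∧
    (∀ g h : K, auxP f z g → auxP f z (h * g * h⁻¹)) ∧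
    (∀ g : K, auxP f z g ∨ g = 1 ∨ auxP f z g⁻¹) ∧
    auxP f z z ∧ (∀ g : K, auxP f z g → g = z ∨ auxP f z (z⁻¹ * g)) := by
  have hmono := aux_zmono hz
  have h0 : auxT z (1 : K) = 0 := by simpa using auxT_zpow hz 0
  have fr : ∀ (k : ℤ) (n : ℕ), f ((k : ℝ) / n) = 0 := fun k n =>
    (hf _).2 ⟨(k : ℚ) / n, by push_cast; rfl⟩
  have fz : ∀ k : ℤ, f (k : ℝ) = 0 := fun k => (hf _).2 ⟨(k : ℚ), by push_cast; rfl⟩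
  -- big elements times elements bounded below
  have bigR : ∀ g h : K, ∀ a : ℤ, (∀ m : ℤ, z ^ m < g) → z ^ a ≤ h → ∀ m : ℤ, z ^ m < g * h := by
    intro g h a hg hh m
    have := mul_lt_mul_of_lt_of_le (hg (m - a)) hh
    rwa [← zpow_add, sub_add_cancel] at this
  have bigL : ∀ g h : K, ∀ a : ℤ, z ^ a ≤ g → (∀ m : ℤ, z ^ m < h) → ∀ m : ℤ, z ^ m < g * h := by
    intro g h a hg hh m
    have := mul_lt_mul_of_le_of_lt hg (hh (m - a))
    rwa [← zpow_add, add_sub_cancel] at this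
  have lower : ∀ g : K, auxP f z g → ∃ a : ℤ, z ^ a ≤ g := by
    rintro g (h | ⟨⟨a, b, h, -⟩, -⟩ | ⟨⟨a, b, h, -⟩, -⟩ | ⟨m, -, rfl⟩)
    · exact ⟨0, (h 0).le⟩
    · exact ⟨a, h⟩
    · exact ⟨a, h⟩
    · exact ⟨m, le_rfl⟩
  -- multiplication of a type-three element by a power of `z`
  have shift : ∀ (g : K) (j : ℤ), auxD z g →
      (∃ (k : ℤ) (n : ℕ), 0 < n ∧ auxT z g = (k : ℝ) / n ∧ z ^ k < g ^ n) →
      (∃ (k : ℤ) (n : ℕ), 0 < n ∧ auxT z (z ^ j * g) = (k : ℝ) / n ∧ z ^ k < (z ^ j * g) ^ n) := by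
    rintro g j hD ⟨k, n, hn, hT, hlt⟩
    refine ⟨j * n + k, n, hn, ?_, ?_⟩
    · rw [auxT_mul hz (auxD_zpow z j) hD, auxT_zpow hz, hT]
      have hn' : (0 : ℝ) < n := by exact_mod_cast hn
      push_cast
      field_simp
    · rw [((hzc g).zpow_left j).mul_pow, zpow_add, zpow_mul, zpow_natCast]
      exact mul_lt_mul_right hlt _
  refine ⟨?_, ?_, ?_, ?_, ?_, ?_⟩
  · rintro (h | ⟨-, h⟩ | ⟨-, k, n, hn, hT, h⟩ | ⟨m, hm, h⟩)
    · simpa using h 0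
    · rw [h0, map_zero] at h; exact lt_irrefl _ h
    · rw [h0, eq_comm, div_eq_zero_iff] at hT
      have hn' : (n : ℝ) ≠ 0 := by exact_mod_cast hn.ne'
      have hk : k = 0 := by simpa [hn'] using hT
      simp [hk] at h
    · have := hmono hm
      simp only [zpow_zero] at this
      exact this.ne h
  · intro g h hg hh
    obtain ⟨a, ha⟩ := lower g hg
    obtain ⟨b, hb⟩ := lower h hh
    rcases hg with hg | hg
    · exact Or.inl (bigR g h b hg hb)
    rcases hh with hh | hh
    · exact Or.inl (bigL g h a ha hh)
    right
    have Dg : auxD z g := by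
      rcases hg with h | h | ⟨m, -, rfl⟩
      exacts [h.1, h.1, auxD_zpow z m]
    have Dh : auxD z h := by
      rcases hh with h | h | ⟨m, -, rfl⟩
      exacts [h.1, h.1, auxD_zpow z m]
    have nonneg : ∀ g : K, ((auxD z g ∧ 0 < f (auxT z g)) ∨
        (auxD z g ∧ ∃ (k : ℤ) (n : ℕ), 0 < n ∧ auxT z g = (k : ℝ) / n ∧ z ^ k < g ^ n) ∨
        (∃ m : ℤ, 0 < m ∧ g = z ^ m)) → 0 ≤ f (auxT z g) := by
      rintro g (h | ⟨-, k, n, -, h, -⟩ | ⟨m, -, rfl⟩)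
      · exact h.2.le
      · rw [h, fr]
      · rw [auxT_zpow hz, fz]
    have n1 := nonneg g hg
    have n2 := nonneg h hh
    have hfT : f (auxT z (g * h)) = f (auxT z g) + f (auxT z h) := by
      rw [auxT_mul hz Dg Dh, map_add]
    have Dgh := auxD_mul Dg Dh
    rcases hg with hg | hg | ⟨m, hm, rfl⟩
    · left; exact ⟨Dgh, by rw [hfT]; linarith [hg.2]⟩
    · rcases hh with hh | hh | ⟨m, hm, rfl⟩
      · left; exact ⟨Dgh, by rw [hfT]; linarith [hh.2]⟩
      · right; left
        refine ⟨Dgh, ?_⟩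
        obtain ⟨-, k, n, hn, hT, hlt⟩ := hg
        obtain ⟨-, l, m, hm, hT', hlt'⟩ := hh
        refine ⟨k * m + l * n, n * m, Nat.mul_pos hn hm, ?_, ?_⟩
        · rw [auxT_mul hz Dg Dh, hT, hT']
          have hm' : (0 : ℝ) < m := by exact_mod_cast hm
          have hn' : (0 : ℝ) < n := by exact_mod_cast hn
          push_cast
          field_simp
        · apply aux_sup_lt (aux_raise_lt hlt hm)
          rw [mul_comm n m]
          exact aux_raise_lt hlt' hn
      · right; left
        refine ⟨Dgh, ?_⟩
        rw [← ((hzc g).zpow_left m).eq]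
        exact shift g m Dg hg.2
    · rcases hh with hh | hh | ⟨l, hl, rfl⟩
      · left; exact ⟨Dgh, by rw [hfT]; linarith [hh.2]⟩
      · right; left
        exact ⟨Dgh, shift h m Dh hh.2⟩
      · right; right
        exact ⟨m + l, by omega, (zpow_add z m l).symm⟩
  · intro g h hg
    rcases hg with hg | hg | ⟨hD, k, n, hn, hT, hlt⟩ | ⟨m, hm, rfl⟩
    · left; intro m
      rw [← not_le, aux_conj_ge hzc, not_le]; exact hg m
    · right; left
      rw [auxD_conj hzc, auxT_conj hzc]; exact hg
    · right; right; left
      rw [auxD_conj hzc, auxT_conj hzc]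
      refine ⟨hD, k, n, hn, hT, ?_⟩
      rw [conj_pow, ← not_le, aux_conj_ge hzc, not_le]; exact hlt
    · right; right; right
      refine ⟨m, hm, ?_⟩
      rw [← ((hzc h).zpow_left m).eq, mul_inv_cancel_right]
  · intro g
    by_cases hD : auxD z g
    · rcases lt_trichotomy (f (auxT z g)) 0 with h | h | h
      · right; right; right; left
        refine ⟨auxD_inv hD, ?_⟩
        rw [auxT_inv hz hD, map_neg]; linarith
      · obtain ⟨q, hq⟩ := (hf _).1 h
        have hqc : (q : ℝ) = (q.num : ℝ) / (q.den : ℝ) := by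
          exact_mod_cast (Rat.num_div_den q).symm
        rcases lt_trichotomy (g ^ q.den) (z ^ q.num) with hl | hl | hl
        · right; right; right; right; left
          refine ⟨auxD_inv hD, -q.num, q.den, q.den_pos, ?_, ?_⟩
          · rw [auxT_inv hz hD, ← hq, hqc]; push_cast; ring
          · rw [zpow_neg, inv_pow]; exact inv_lt_inv_iff.2 hl
        · obtain ⟨m, rfl⟩ := hiso g q.den q.den_pos ⟨_, hl⟩
          rcases lt_trichotomy m 0 with hm | hm | hm
          · right; right; right; right; right
            exact ⟨-m, by omega, by rw [zpow_neg]⟩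
          · right; left; simp [hm]
          · left; right; right; right; exact ⟨m, hm, rfl⟩
        · left; right; right; left
          exact ⟨hD, q.num, q.den, q.den_pos, by rw [← hq, hqc], hl⟩
      · left; right; left; exact ⟨hD, h⟩
    · by_cases h1 : ∃ a : ℤ, z ^ a ≤ g
      · left; left
        intro m
        by_contra hm
        obtain ⟨a, ha⟩ := h1
        exact hD ⟨a, m, ha, not_lt.1 hm⟩
      · right; right; left
        intro m
        push Not at h1
        have := inv_lt_inv_iff.2 (h1 (-m))
        rwa [zpow_neg, inv_inv] at this
  · right; right; right
    exact ⟨1, one_pos, by simp⟩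
  · intro g hg
    have Dz : auxD z z⁻¹ := by simpa using auxD_zpow z (-1)
    have Tz : auxT z z⁻¹ = -1 := by simpa using auxT_zpow hz (-1)
    rcases hg with hg | hg | ⟨hD, h⟩ | ⟨m, hm, rfl⟩
    · right; left
      exact bigL z⁻¹ g (-1) (by simp) hg
    · right; right; left
      refine ⟨auxD_mul Dz hg.1, ?_⟩
      have e := fz (-1)
      push_cast at e
      rw [auxT_mul hz Dz hg.1, Tz, map_add, e, zero_add]
      exact hg.2
    · right; right; right; left
      refine ⟨auxD_mul Dz hD, ?_⟩
      simpa using shift g (-1) hD h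
    · rcases eq_or_ne m 1 with h | h
      · left; simp [h]
      · right; right; right; right
        refine ⟨m - 1, by omega, ?_⟩
        rw [zpow_sub_one, ← ((hzc z⁻¹).zpow_left m).eq]

end Aux

/-- The main result for a given bi-order in which `z` is positive. -/
theorem aux_main {K : Type*} [Group K] (r : K → K → Prop) (hr : IsRightOrder r)
    (hl : ∀ f g h : K, r f g → r (h * f) (h * g)) (z : K) (hz : r 1 z)
    (hzc : z ∈ Subgroup.center K)
    (hiso : ∀ g ∈ Subgroup.center K, ∀ n : ℕ, 0 < n →
      g ^ n ∈ Subgroup.zpowers z → g ∈ Subgroup.zpowers z) :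
    ∃ r : K → K → Prop, IsRightOrder r ∧ (∀ f g h : K, r f g → r (h * f) (h * g)) ∧
      LeastPos r z := by
  classical
  haveI := hr.1
  letI : LinearOrder K := linearOrderOfSTO r
  haveI : MulLeftStrictMono K := ⟨fun h f g hfg => hl f g h hfg⟩
  haveI : MulRightStrictMono K := ⟨fun h f g hfg => hr.2 f g h hfg⟩
  haveI : MulLeftMono K := mulLeftMono_of_mulLeftStrictMono K
  haveI : MulRightMono K := mulRightMono_of_mulRightStrictMono K
  have hz' : 1 < z := hz
  have hc : ∀ x : K, Commute z x := fun x => (Subgroup.mem_center_iff.1 hzc x).symm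
  have hiso' : ∀ (g : K) (n : ℕ), 0 < n → (∃ k : ℤ, g ^ n = z ^ k) → ∃ m : ℤ, g = z ^ m := by
    rintro g n hn ⟨k, hk⟩
    have hg : g ∈ Subgroup.center K := by
      rw [Subgroup.mem_center_iff]
      intro h
      have e : (h * g * h⁻¹) ^ n = g ^ n := by
        rw [conj_pow, hk, ← ((hc h).zpow_left k).eq, mul_inv_cancel_right]
      have e2 := (pow_left_strictMono (M := K) hn.ne').injective e
      exact mul_inv_eq_iff_eq_mul.1 e2
    obtain ⟨m, hm⟩ := Subgroup.mem_zpowers_iff.1 (hiso g hg n hn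
      (Subgroup.mem_zpowers_iff.2 ⟨k, hk.symm⟩))
    exact ⟨m, hm.symm⟩
  obtain ⟨f, hf⟩ := aux_proj
  obtain ⟨p1, pm, pc, pt, pz, pl⟩ := auxP_cone hz' hc hiso' f hf
  refine ⟨fun a b => auxP f z (a⁻¹ * b), ⟨?_, ?_⟩, ?_, ?_, ?_⟩
  · refine { trichotomous := ?_, irrefl := ?_, trans := ?_ }
    · intro a b h1 h2
      rcases pt (a⁻¹ * b) with h | h | h
      · exact absurd h h1
      · exact inv_mul_eq_one.1 h
      · rw [mul_inv_rev, inv_inv] at h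
        exact absurd h h2
    · intro a h
      rw [inv_mul_cancel] at h
      exact p1 h
    · intro a b c h1 h2
      have := pm _ _ h1 h2
      rwa [mul_assoc, mul_inv_cancel_left] at this
  · intro a b h hab
    have := pc _ h⁻¹ hab
    simpa [mul_assoc] using this
  · intro a b h hab
    simpa [mul_assoc] using hab
  · simpa using pz
  · intro g hg
    exact pl g (by simpa using hg)

theorem stmt5 (hord : ∃ r : G → G → Prop, IsRightOrder r ∧ ∀ f g h : G, r f g → r (h * f) (h * g))
    (z : G) (hzc : z ∈ Subgroup.center G) (hzinf : ¬ IsOfFinOrder z)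
    (hiso : ∀ g ∈ Subgroup.center G, ∀ n : ℕ, 0 < n →
      g ^ n ∈ Subgroup.zpowers z → g ∈ Subgroup.zpowers z) :
    ∃ r : G → G → Prop, IsRightOrder r ∧ (∀ f g h : G, r f g → r (h * f) (h * g)) ∧
      LeastPos r z := by
  obtain ⟨r, hr, hl⟩ := hord
  have hne : z ≠ 1 := by
    rintro rfl
    exact hzinf IsOfFinOrder.one
  haveI := hr.1
  rcases trichotomous_of r 1 z with h | h | h
  · exact aux_main r hr hl z h hzc hiso
  · exact absurd h.symm hne
  · refine aux_main (fun a b => r b a) ⟨?_, fun f g h => hr.2 g f h⟩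
      (fun f g h => hl g f h) z h hzc hiso
    exact IsStrictTotalOrder.swap r
end

section
/- The Dehornoy right-order on the braid group B_n (n ≥ 2) is discrete, with smallest positive element σ_{n−1}. -/
variable {G : Type*} [Group G]

/-- The braid relations on `n - 1` generators `σ_1, …, σ_{n-1}` (generator `i : Fin (n-1)`
is `σ_{i+1}`): `σᵢσⱼ = σⱼσᵢ` for `|i - j| > 1` and `σᵢσⱼσᵢ = σⱼσᵢσⱼ` for `|i - j| = 1`. -/
def braidRels (n : ℕ) : Set (FreeGroup (Fin (n - 1))) :=
  {w | (∃ i j : Fin (n - 1), (i : ℕ) + 1 < (j : ℕ) ∧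
          w = FreeGroup.of i * FreeGroup.of j * (FreeGroup.of i)⁻¹ * (FreeGroup.of j)⁻¹) ∨
       (∃ i j : Fin (n - 1), (i : ℕ) + 1 = (j : ℕ) ∧
          w = FreeGroup.of i * FreeGroup.of j * FreeGroup.of i *
            (FreeGroup.of j * FreeGroup.of i * FreeGroup.of j)⁻¹)}

/-- The braid group `Bₙ`. -/
abbrev BraidGroup (n : ℕ) := PresentedGroup (braidRels n)

/-- The Dehornoy positive cone: braids expressible by a word (a reduced or unreduced
list of generators and signs) in which the generator of lowest index occurs, and occurs
only with positive exponents. -/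
def DehornoyPos (n : ℕ) : Set (BraidGroup n) :=
  {g | ∃ L : List (Fin (n - 1) × Bool),
        PresentedGroup.mk (braidRels n) (FreeGroup.mk L) = g ∧
        ∃ i : Fin (n - 1), (∃ p ∈ L, p.1 = i) ∧ (∀ p ∈ L, i ≤ p.1) ∧
          (∀ p ∈ L, p.1 = i → p.2 = true)}

open Relation

/-- Paths using label `i` only upwards, and larger labels freely. -/
def BrR {V : Type*} (E : ℕ → V → V → Prop) (i : ℕ) : V → V → Prop :=
  ReflTransGen (fun u v => E i u v ∨ ∃ j, i < j ∧ (E j u v ∨ E j v u))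

/-- Paths using labels at least `i` freely. -/
def BrA {V : Type*} (E : ℕ → V → V → Prop) (i : ℕ) : V → V → Prop :=
  ReflTransGen (fun u v => ∃ j, i ≤ j ∧ (E j u v ∨ E j v u))

/-- Paths as in `BrR` using label `i` at least once. -/
def BrP {V : Type*} (E : ℕ → V → V → Prop) (i : ℕ) (u v : V) : Prop :=
  ∃ a b, BrR E i u a ∧ E i a b ∧ BrR E i b v

/-- Finite labelled graphs behaving like a bounded part of the Cayley graph. -/
structure BrGraph {V : Type*} (m : ℕ) (E : ℕ → V → V → Prop) : Prop where
  u0 : ∀ i u v v', E i u v → E i u v' → v = v'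
  d0 : ∀ i u v v', E i v u → E i v' u → v = v'
  u1 : ∀ i u v v', E i u v → E (i+1) u v' →
    ∃ s z y, E (i+1) v s ∧ E i s z ∧ E i v' y ∧ E (i+1) y z
  d1 : ∀ i u v v', E i v u → E (i+1) v' u →
    ∃ s z y, E (i+1) s v ∧ E i z s ∧ E i y v' ∧ E (i+1) z y
  u2 : ∀ i j u v v', i + 1 < j → E i u v → E j u v' → ∃ z, E j v z ∧ E i v' z
  d2 : ∀ i j u v v', i + 1 < j → E i v u → E j v' u → ∃ z, E j z v ∧ E i z v'
  c1 : ∀ i j u v z, i + 1 < j → E j u v → E i v z → ∃ y, E i u y ∧ E j y z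
  c2 : ∀ i j u v z, i + 1 < j → E i u v → E j v z → ∃ y, E j u y ∧ E i y z
  acyc : ∀ i u, ¬ BrP E i u u
  bound : ∀ i u v, E i u v → i < m

theorem brR_op {V : Type*} (E : ℕ → V → V → Prop) (i : ℕ) (u v : V) :
    BrR (fun i u v => E i v u) i u v ↔ BrR E i v u := by
  unfold BrR
  rw [← reflTransGen_swap]

theorem BrGraph.op {V : Type*} {m : ℕ} {E : ℕ → V → V → Prop} (h : BrGraph m E) :
    BrGraph m (fun i u v => E i v u) where
  u0 := h.d0
  d0 := h.u0
  u1 := h.d1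
  d1 := h.u1
  u2 := h.d2
  d2 := h.u2
  c1 := by
    intro i j u v z hij h1 h2
    obtain ⟨y, h3, h4⟩ := h.c2 i j _ _ _ hij h2 h1
    exact ⟨y, h4, h3⟩
  c2 := by
    intro i j u v z hij h1 h2
    obtain ⟨y, h3, h4⟩ := h.c1 i j _ _ _ hij h2 h1
    exact ⟨y, h4, h3⟩
  acyc := by
    rintro i u ⟨a, b, h1, h2, h3⟩
    rw [brR_op] at h1 h3
    exact h.acyc i u ⟨b, a, h3, h2, h1⟩
  bound := fun i u v => h.bound i v u

theorem brA_symm {V : Type*} {E : ℕ → V → V → Prop} {i : ℕ} {u v : V} (h : BrA E i u v) :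
    BrA E i v u := by
  unfold BrA at *
  induction h with
  | refl => exact ReflTransGen.refl
  | tail _ hs ih =>
    obtain ⟨j, hj, h⟩ := hs
    exact ReflTransGen.head ⟨j, hj, h.symm⟩ ih

theorem brA_R {V : Type*} {E : ℕ → V → V → Prop} {i : ℕ} {u v : V} (h : BrA E (i+1) u v) :
    BrR E i u v := by
  refine ReflTransGen.mono ?_ _ _ h
  rintro a b ⟨j, hj, h⟩
  exact Or.inr ⟨j, hj, h⟩

theorem brR_decomp {V : Type*} {E : ℕ → V → V → Prop} {i : ℕ} {u v : V} (h : BrR E i u v) :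
    BrA E (i+1) u v ∨ ∃ a b, BrA E (i+1) u a ∧ E i a b ∧ BrR E i b v := by
  induction h using ReflTransGen.head_induction_on with
  | refl => exact Or.inl ReflTransGen.refl
  | head h1 h2 ih =>
    rcases h1 with h1 | ⟨j, hj, h1⟩
    · exact Or.inr ⟨_, _, ReflTransGen.refl, h1, h2⟩
    · rcases ih with ih | ⟨a, b, ha, hb, hc⟩
      · exact Or.inl (ReflTransGen.head ⟨j, hj, h1⟩ ih)
      · exact Or.inr ⟨a, b, ReflTransGen.head ⟨j, hj, h1⟩ ha, hb, hc⟩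

theorem BrGraph.push {V : Type*} {m : ℕ} {E : ℕ → V → V → Prop} (h : BrGraph m E) {i : ℕ}
    {v x v2 : V} (hR : BrR E (i+1) v x) (h1 : E i v v2) : ∃ y, E i x y ∧ BrR E i v2 y := by
  induction hR with
  | refl => exact ⟨_, h1, ReflTransGen.refl⟩
  | tail _ hs ih =>
    obtain ⟨y, hy, hR⟩ := ih
    rcases hs with hs | ⟨j, hj, hs | hs⟩
    · obtain ⟨s, z, y', e1, e2, e3, e4⟩ := h.u1 _ _ _ _ hy hs
      refine ⟨y', e3, ?_⟩
      refine ((hR.tail (Or.inr ⟨i+1, by omega, Or.inl e1⟩)).tail (Or.inl e2)).tail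
        (Or.inr ⟨i+1, by omega, Or.inr e4⟩)
    · obtain ⟨z, e1, e2⟩ := h.u2 _ _ _ _ _ hj hy hs
      exact ⟨z, e2, hR.tail (Or.inr ⟨j, by omega, Or.inl e1⟩)⟩
    · obtain ⟨z, e1, e2⟩ := h.c1 _ _ _ _ _ hj hs hy
      exact ⟨z, e1, hR.tail (Or.inr ⟨j, by omega, Or.inr e2⟩)⟩

theorem BrGraph.valley {V : Type*} [Finite V] {m : ℕ} {E : ℕ → V → V → Prop} (h : BrGraph m E)
    {i : ℕ} (hT : ∀ u v, BrA E (i+1) u v → BrR E (i+1) u v ∨ BrR E (i+1) v u) :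
    ∀ v p q, BrR E i v p → BrR E i v q → BrR E i p q ∨ BrR E i q p := by
  let r : V → V → Prop := fun a b => BrP E i b a
  have : IsTrans V r := ⟨by
    rintro x y z ⟨a, b, h1, h2, h3⟩ ⟨a', b', h1', h2', h3'⟩
    exact ⟨a', b', h1', h2', h3'.trans (h1.trans (ReflTransGen.head (Or.inl h2) h3))⟩⟩
  have : Std.Irrefl r := ⟨fun a => h.acyc i a⟩
  have wf : WellFounded r := Finite.wellFounded_of_trans_of_irrefl r
  intro v
  induction v using wf.induction with
  | _ v ih =>
  intro p q hp hq
  rcases brR_decomp hp with hp' | ⟨a, b, ha, hab, hb⟩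
  · left; exact (brA_R (brA_symm hp')).trans hq
  rcases brR_decomp hq with hq' | ⟨a', b', ha', hab', hb'⟩
  · right; exact (brA_R (brA_symm hq')).trans hp
  rcases hT a a' ((brA_symm ha).trans ha') with hh | hh
  · obtain ⟨y, h1, h2⟩ := h.push hh hab
    obtain rfl := h.u0 _ _ _ _ h1 hab'
    exact ih b ⟨a, b, brA_R ha, hab, ReflTransGen.refl⟩ p q hb (h2.trans hb')
  · obtain ⟨y, h1, h2⟩ := h.push hh hab'
    obtain rfl := h.u0 _ _ _ _ h1 hab
    exact ih b' ⟨a', b', brA_R ha', hab', ReflTransGen.refl⟩ p q (h2.trans hb) hb'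

theorem BrGraph.total {V : Type*} [Finite V] {m : ℕ} {E : ℕ → V → V → Prop} (h : BrGraph m E) :
    ∀ k i, m ≤ i + k → ∀ u v, BrA E i u v → BrR E i u v ∨ BrR E i v u := by
  intro k
  induction k with
  | zero =>
    intro i hi u v huv
    left
    refine ReflTransGen.mono ?_ _ _ huv
    rintro a b ⟨j, hj, hE | hE⟩ <;> have := h.bound _ _ _ hE <;> omega
  | succ k ih =>
    intro i hi u v huv
    have val := h.valley (ih (i+1) (by omega))
    have val' := h.op.valley (i := i) (by
      intro u v huv
      simp only [brR_op]
      refine (ih (i+1) (by omega) u v ?_).symm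
      refine ReflTransGen.mono ?_ _ _ huv
      rintro a b ⟨j, hj, hE⟩
      exact ⟨j, hj, hE.symm⟩)
    simp only [brR_op] at val'
    induction huv with
    | refl => exact Or.inl ReflTransGen.refl
    | @tail b c _ hs ihh =>
      have key : BrR E i b c ∨ BrR E i c b := by
        obtain ⟨j, hj, hE⟩ := hs
        rcases Nat.eq_or_lt_of_le hj with rfl | hj
        · rcases hE with hE | hE
          · exact Or.inl (ReflTransGen.single (Or.inl hE))
          · exact Or.inr (ReflTransGen.single (Or.inl hE))
        · exact Or.inl (ReflTransGen.single (Or.inr ⟨j, hj, hE⟩))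
      rcases ihh with h1 | h1 <;> rcases key with h2 | h2
      · exact Or.inl (h1.trans h2)
      · exact (val' _ _ _ h1 h2).symm
      · exact val _ _ _ h1 h2
      · exact Or.inr (h2.trans h1)

theorem BrGraph.tricho {V : Type*} [Finite V] {m : ℕ} {E : ℕ → V → V → Prop} (h : BrGraph m E) :
    ∀ k i, m ≤ i + k → ∀ u v, BrA E i u v → u = v ∨ ∃ j, BrP E j u v ∨ BrP E j v u := by
  intro k
  induction k with
  | zero =>
    intro i hi u v huv
    left
    induction huv with
    | refl => rfl
    | tail _ hs _ =>
      obtain ⟨j, hj, hE | hE⟩ := hs <;> have := h.bound _ _ _ hE <;> omega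
  | succ k ih =>
    intro i hi u v huv
    rcases h.total _ i hi u v huv with hR | hR
    · rcases brR_decomp hR with hA | ⟨a, b, ha, hab, hb⟩
      · exact ih (i+1) (by omega) u v hA
      · exact Or.inr ⟨i, Or.inl ⟨a, b, brA_R ha, hab, hb⟩⟩
    · rcases brR_decomp hR with hA | ⟨a, b, ha, hab, hb⟩
      · exact ih (i+1) (by omega) u v (brA_symm hA)
      · exact Or.inr ⟨i, Or.inr ⟨a, b, brA_R ha, hab, hb⟩⟩

/-- The reduced word of `w` ends with the letter `l`. -/
def BrE (l : ℕ × Bool) (w : FreeGroup ℕ) : Prop := w.toWord.getLast? = some l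

theorem brE_excl {l l' : ℕ × Bool} {w : FreeGroup ℕ} (h : BrE l w) (h' : BrE l' w) : l = l' := by
  unfold BrE at *
  rw [h] at h'
  exact Option.some.inj h'

theorem brE_one (l : ℕ × Bool) : ¬ BrE l 1 := by
  simp [BrE]

theorem toWord_of_mul (k : ℕ) (w : FreeGroup ℕ) :
    (FreeGroup.of k * w).toWord = List.casesOn w.toWord [(k, true)]
      (fun hd tl => if k = hd.1 ∧ true = !hd.2 then tl else (k, true) :: hd :: tl) := by
  rw [FreeGroup.toWord_mul, FreeGroup.toWord_of, List.singleton_append, FreeGroup.reduce.cons,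
    FreeGroup.reduce_toWord]

theorem brE_pos (a k : ℕ) (w : FreeGroup ℕ) :
    BrE (a, true) (FreeGroup.of k * w) ↔ Xor (BrE (a, true) w) (k = a ∧ w = 1) := by
  unfold BrE
  rw [toWord_of_mul, ← FreeGroup.toWord_eq_nil_iff]
  rcases w.toWord with _ | ⟨⟨b, e⟩, tl⟩
  · simp [Xor]
  · rcases tl with _ | ⟨c, tl⟩
    · cases e <;> simp [Xor]
      split_ifs <;> simp_all
    · simp only [Xor]
      split_ifs <;> simp

theorem brE_neg (a k : ℕ) (w : FreeGroup ℕ) :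
    BrE (a, false) (FreeGroup.of k * w) ↔
      Xor (BrE (a, false) w) (k = a ∧ w = (FreeGroup.of a)⁻¹) := by
  unfold BrE
  rw [toWord_of_mul, ← FreeGroup.toWord_inj (y := (FreeGroup.of a)⁻¹), FreeGroup.toWord_inv,
    FreeGroup.toWord_of]
  rcases w.toWord with _ | ⟨⟨b, e⟩, tl⟩
  · simp [Xor, FreeGroup.invRev]
  · rcases tl with _ | ⟨c, tl⟩
    · cases e <;> simp [Xor, FreeGroup.invRev]
      split_ifs <;> simp_all
      omega
    · simp only [Xor, FreeGroup.invRev]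
      split_ifs <;> simp

theorem free_ind {P : FreeGroup ℕ → Prop} (h1 : P 1) (h : ∀ k w, P w ↔ P (FreeGroup.of k * w))
    (w : FreeGroup ℕ) : P w := by
  rw [← FreeGroup.mk_toWord (x := w)]
  induction w.toWord with
  | nil => exact h1
  | cons x L ih =>
    rcases x with ⟨k, _ | _⟩
    · rw [h k]
      have : FreeGroup.of k * FreeGroup.mk ((k, false) :: L) = FreeGroup.mk L := by
        have : FreeGroup.mk ((k, false) :: L) = (FreeGroup.of k)⁻¹ * FreeGroup.mk L := by
          simp [FreeGroup.of, FreeGroup.inv_mk, FreeGroup.mul_mk, FreeGroup.invRev]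
        rw [this]; group
      rwa [this]
    · have : FreeGroup.mk ((k, true) :: L) = FreeGroup.of k * FreeGroup.mk L := by
        simp [FreeGroup.of, FreeGroup.mul_mk]
      rw [this, ← h k]
      exact ih

def brF (i : ℕ) : FreeGroup ℕ →* FreeGroup ℕ := FreeGroup.lift fun k =>
  if k = i then (FreeGroup.of i)⁻¹ * FreeGroup.of (i+1) * FreeGroup.of i
  else if k = i + 1 then FreeGroup.of i else FreeGroup.of k

def brF' (i : ℕ) : FreeGroup ℕ →* FreeGroup ℕ := FreeGroup.lift fun k =>
  if k = i then FreeGroup.of (i+1)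
  else if k = i + 1 then FreeGroup.of (i+1) * FreeGroup.of i * (FreeGroup.of (i+1))⁻¹
  else FreeGroup.of k

theorem brF_self (i : ℕ) :
    brF i (FreeGroup.of i) = (FreeGroup.of i)⁻¹ * FreeGroup.of (i+1) * FreeGroup.of i := by
  simp [brF]

theorem brF_succ (i : ℕ) : brF i (FreeGroup.of (i+1)) = FreeGroup.of i := by
  simp [brF]

theorem brF_other (i k : ℕ) (h : k ≠ i) (h' : k ≠ i+1) :
    brF i (FreeGroup.of k) = FreeGroup.of k := by
  simp [brF, h, h']

theorem brF'_self (i : ℕ) : brF' i (FreeGroup.of i) = FreeGroup.of (i+1) := by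
  simp [brF']

theorem brF'_succ (i : ℕ) : brF' i (FreeGroup.of (i+1)) =
    FreeGroup.of (i+1) * FreeGroup.of i * (FreeGroup.of (i+1))⁻¹ := by
  simp [brF']

theorem brF'_other (i k : ℕ) (h : k ≠ i) (h' : k ≠ i+1) :
    brF' i (FreeGroup.of k) = FreeGroup.of k := by
  simp [brF', h, h']

def brAut (i : ℕ) : MulAut (FreeGroup ℕ) := MonoidHom.toMulEquiv (brF i) (brF' i)
  (by
    ext k
    rcases eq_or_ne k i with rfl | h1
    · simp [brF_self, brF'_self, brF'_succ, mul_assoc]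
    · rcases eq_or_ne k (i+1) with rfl | h2
      · simp [brF_succ, brF'_self]
      · simp [brF_other, brF'_other, h1, h2])
  (by
    ext k
    rcases eq_or_ne k i with rfl | h1
    · simp [brF'_self, brF_succ]
    · rcases eq_or_ne k (i+1) with rfl | h2
      · simp [brF_self, brF'_succ, brF_succ, mul_assoc]
      · simp [brF_other, brF'_other, h1, h2])

theorem brAut_apply (i : ℕ) (w) : brAut i w = brF i w := rfl

theorem brAut_ext {f g : MulAut (FreeGroup ℕ)} (h : ∀ k, f (FreeGroup.of k) = g (FreeGroup.of k)) :
    f = g := by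
  have : f.toMonoidHom = g.toMonoidHom := FreeGroup.ext_hom _ _ h
  ext w
  exact DFunLike.congr_fun this w

theorem brAut_comm (i j : ℕ) (h : i + 1 < j) : brAut i * brAut j = brAut j * brAut i := by
  apply brAut_ext
  intro k
  simp only [MulAut.mul_apply, brAut_apply]
  have e1 := brF_other j i (by omega) (by omega)
  have e2 := brF_other j (i+1) (by omega) (by omega)
  have e3 := brF_other i j (by omega) (by omega)
  have e4 := brF_other i (j+1) (by omega) (by omega)
  rcases eq_or_ne k i with rfl | h1
  · simp [brF_self, e1, e2]
  rcases eq_or_ne k (i+1) with rfl | h2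
  · simp [brF_succ, e1, e2]
  rcases eq_or_ne k j with rfl | h3
  · simp [brF_self, e3, e4]
  rcases eq_or_ne k (j+1) with rfl | h4
  · simp [brF_succ, e3, e4]
  simp [brF_other, h1, h2, h3, h4]

theorem brAut_braid (i : ℕ) :
    brAut i * brAut (i+1) * brAut i = brAut (i+1) * brAut i * brAut (i+1) := by
  apply brAut_ext
  intro k
  simp only [MulAut.mul_apply, brAut_apply]
  have e1 := brF_other (i+1) i (by omega) (by omega)
  have e2 := brF_other i (i+1+1) (by omega) (by omega)
  rcases eq_or_ne k i with rfl | h1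
  · simp [brF_self, brF_succ, e1, e2, mul_assoc]
  rcases eq_or_ne k (i+1) with rfl | h2
  · simp [brF_self, brF_succ, e1, e2, mul_assoc]
  rcases eq_or_ne k (i+1+1) with rfl | h3
  · simp [brF_self, brF_succ, e1, e2, mul_assoc]
  simp [brF_other, h1, h2, h3]

theorem brAut_E_self (i : ℕ) (w : FreeGroup ℕ) : BrE (i, true) (brAut i w) ↔
    BrE (i, true) w ∨ BrE (i, false) w ∨ BrE (i+1, true) w := by
  refine free_ind (P := fun w => BrE (i, true) (brAut i w) ↔
    BrE (i, true) w ∨ BrE (i, false) w ∨ BrE (i+1, true) w) ?_ ?_ w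
  · simp [brE_one]
  intro k w
  have x1 : BrE (i, true) w → ¬ BrE (i, false) w := fun h h' => by simpa using brE_excl h h'
  have x2 : BrE (i, true) w → ¬ BrE (i+1, true) w := fun h h' => by simpa using brE_excl h h'
  have x3 : BrE (i, false) w → ¬ BrE (i+1, true) w := fun h h' => by simpa using brE_excl h h'
  have y1 : BrE (i, true) (FreeGroup.of k * w) → ¬ BrE (i, false) (FreeGroup.of k * w) :=
    fun h h' => by simpa using brE_excl h h'
  have y2 : BrE (i, true) (FreeGroup.of k * w) → ¬ BrE (i+1, true) (FreeGroup.of k * w) :=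
    fun h h' => by simpa using brE_excl h h'
  have y3 : BrE (i, false) (FreeGroup.of k * w) → ¬ BrE (i+1, true) (FreeGroup.of k * w) :=
    fun h h' => by simpa using brE_excl h h'
  have q1 : brAut i w = 1 ↔ w = 1 := by simp
  have h1 := brE_pos i k w
  have h2 := brE_neg i k w
  have h3 := brE_pos (i+1) k w
  rcases eq_or_ne k i with rfl | n1
  · have q2 : brAut k (FreeGroup.of k * w) = 1 ↔ w = (FreeGroup.of k)⁻¹ := by
      rw [EmbeddingLike.map_eq_one_iff, mul_eq_one_iff_eq_inv']
    have e : FreeGroup.of k * brAut k (FreeGroup.of k * w) =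
        FreeGroup.of (k+1) * (FreeGroup.of k * brAut k w) := by
      rw [map_mul, brAut_apply k (FreeGroup.of k), brF_self]; group
    have s1 := brE_pos k k (brAut k (FreeGroup.of k * w))
    have s2 := brE_pos k (k+1) (FreeGroup.of k * brAut k w)
    have s3 := brE_pos k k (brAut k w)
    rw [e] at s1
    rw [q2] at s1
    rw [q1] at s3
    have hne : w = 1 → w ≠ (FreeGroup.of k)⁻¹ := by
      rintro rfl h; simp [eq_comm] at h
    simp only [Xor] at *
    have : k + 1 ≠ k := by omega
    have : k ≠ k + 1 := by omega
    grind
  · rcases eq_or_ne k (i+1) with rfl | n2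
    · have e : brAut i (FreeGroup.of (i+1) * w) = FreeGroup.of i * brAut i w := by
        rw [map_mul, brAut_apply i (FreeGroup.of (i+1)), brF_succ]
      have s := brE_pos i i (brAut i w)
      rw [← e, q1] at s
      simp only [Xor] at *
      grind
    · have e : brAut i (FreeGroup.of k * w) = FreeGroup.of k * brAut i w := by
        rw [map_mul, brAut_apply i (FreeGroup.of k), brF_other i k n1 n2]
      have s := brE_pos i k (brAut i w)
      rw [← e, q1] at s
      simp only [Xor] at *
      grind

theorem brAut_E_other (i j : ℕ) (hj : i < j) (w : FreeGroup ℕ) :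
    BrE (i, true) (brAut j w) ↔ BrE (i, true) w := by
  refine free_ind (P := fun w => BrE (i, true) (brAut j w) ↔ BrE (i, true) w) ?_ ?_ w
  · simp [brE_one]
  intro k w
  have q1 : brAut j w = 1 ↔ w = 1 := by simp
  have h1 := brE_pos i k w
  rcases eq_or_ne k j with rfl | n1
  · have e : FreeGroup.of k * brAut k (FreeGroup.of k * w) =
        FreeGroup.of (k+1) * (FreeGroup.of k * brAut k w) := by
      rw [map_mul, brAut_apply k (FreeGroup.of k), brF_self]; group
    have s1 := brE_pos i k (brAut k (FreeGroup.of k * w))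
    have s2 := brE_pos i (k+1) (FreeGroup.of k * brAut k w)
    have s3 := brE_pos i k (brAut k w)
    rw [e] at s1
    have : k + 1 ≠ i := by omega
    have : k ≠ i := by omega
    simp only [Xor] at *
    grind
  · rcases eq_or_ne k (j+1) with rfl | n2
    · have e : brAut j (FreeGroup.of (j+1) * w) = FreeGroup.of j * brAut j w := by
        rw [map_mul, brAut_apply j (FreeGroup.of (j+1)), brF_succ]
      have s := brE_pos i j (brAut j w)
      rw [← e] at s
      have : j ≠ i := by omega
      have : j + 1 ≠ i := by omega
      simp only [Xor] at *
      grind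
    · have e : brAut j (FreeGroup.of k * w) = FreeGroup.of k * brAut j w := by
        rw [map_mul, brAut_apply j (FreeGroup.of k), brF_other j k n1 n2]
      have s := brE_pos i k (brAut j w)
      rw [← e, q1] at s
      simp only [Xor] at *
      grind

def BrFar {m : ℕ} (i j : Fin m) : Prop := (i : ℕ) + 1 < j ∨ (j : ℕ) + 1 < i
def BrAdj {m : ℕ} (i j : Fin m) : Prop := (i : ℕ) + 1 = j ∨ (j : ℕ) + 1 = i

/-- One application of a positive braid relation. -/
inductive BrStep {m : ℕ} : List (Fin m) → List (Fin m) → Prop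
  | cons (i : Fin m) {l l' : List (Fin m)} : BrStep l l' → BrStep (i :: l) (i :: l')
  | comm {i j : Fin m} (h : BrFar i j) (l : List (Fin m)) : BrStep (i :: j :: l) (j :: i :: l)
  | braid {i j : Fin m} (h : BrAdj i j) (l : List (Fin m)) :
      BrStep (i :: j :: i :: l) (j :: i :: j :: l)

theorem BrFar.symm {m : ℕ} {i j : Fin m} (h : BrFar i j) : BrFar j i := Or.symm h
theorem BrAdj.symm {m : ℕ} {i j : Fin m} (h : BrAdj i j) : BrAdj j i := Or.symm h

theorem BrStep.symm {m : ℕ} {l l' : List (Fin m)} (h : BrStep l l') : BrStep l' l := by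
  induction h with
  | cons i _ ih => exact .cons i ih
  | comm h l => exact .comm h.symm l
  | braid h l => exact .braid h.symm l

theorem BrStep.append_left {m : ℕ} (k : List (Fin m)) {l l' : List (Fin m)} (h : BrStep l l') :
    BrStep (k ++ l) (k ++ l') := by
  induction k with
  | nil => exact h
  | cons a k ih => exact .cons a ih

theorem BrStep.append_right {m : ℕ} (k : List (Fin m)) {l l' : List (Fin m)} (h : BrStep l l') :
    BrStep (l ++ k) (l' ++ k) := by
  induction h with
  | cons i _ ih => exact .cons i ih
  | comm h l => exact .comm h (l ++ k)
  | braid h l => exact .braid h (l ++ k)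

theorem BrStep.length {m : ℕ} {l l' : List (Fin m)} (h : BrStep l l') : l.length = l'.length := by
  induction h with
  | cons i _ ih => simp [ih]
  | comm h l => simp
  | braid h l => simp

theorem BrStep.reverse {m : ℕ} {l l' : List (Fin m)} (h : BrStep l l') :
    BrStep l.reverse l'.reverse := by
  induction h with
  | cons i _ ih => simpa using ih.append_right [i]
  | comm h l => simpa using (BrStep.comm h.symm []).append_left l.reverse
  | braid h l => simpa using (BrStep.braid h []).append_left l.reverse

/-- The positive braid congruence. -/
def brCon (m : ℕ) : Con (FreeMonoid (Fin m)) where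
  r := fun a b => ReflTransGen BrStep (FreeMonoid.toList a) (FreeMonoid.toList b)
  iseqv := by
    refine ⟨fun _ => ReflTransGen.refl, ?_, fun h h' => h.trans h'⟩
    intro x y h
    generalize FreeMonoid.toList x = x at h ⊢
    generalize FreeMonoid.toList y = y at h ⊢
    induction h with
    | refl => exact ReflTransGen.refl
    | tail _ hs ih => exact ReflTransGen.head hs.symm ih
  mul' := by
    intro a b c d h h'
    rw [FreeMonoid.toList_mul, FreeMonoid.toList_mul]
    refine ReflTransGen.trans (ReflTransGen.lift (fun l => l ++ FreeMonoid.toList c)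
      (fun _ _ h => h.append_right _) _ _ h) ?_
    exact ReflTransGen.lift (fun l => FreeMonoid.toList b ++ l) (fun _ _ h => h.append_left _) _ _ h'

abbrev BrMon (m : ℕ) := (brCon m).Quotient

def BrMon.w {m : ℕ} (l : List (Fin m)) : BrMon m := ((FreeMonoid.ofList l : FreeMonoid (Fin m)) : BrMon m)

def BrMon.s {m : ℕ} (i : Fin m) : BrMon m := BrMon.w [i]

open BrMon

theorem BrMon.w_surj {m : ℕ} (x : BrMon m) : ∃ l, w l = x := by
  induction x using Con.induction_on with
  | _ x => exact ⟨FreeMonoid.toList x, rfl⟩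

theorem BrMon.w_eq {m : ℕ} {l l' : List (Fin m)} : w l = w l' ↔ ReflTransGen BrStep l l' :=
  (brCon m).eq

theorem BrMon.w_append {m : ℕ} (l l' : List (Fin m)) : w (l ++ l') = w l * w l' := rfl
theorem BrMon.w_cons {m : ℕ} (i : Fin m) (l : List (Fin m)) : w (i :: l) = s i * w l := rfl
theorem BrMon.w_nil {m : ℕ} : w ([] : List (Fin m)) = 1 := rfl

theorem BrMon.ind {m : ℕ} {P : BrMon m → Prop} (h1 : P 1) (h : ∀ i x, P x → P (s i * x)) (x) :
    P x := by
  obtain ⟨l, rfl⟩ := w_surj x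
  induction l with
  | nil => exact h1
  | cons i l ih => exact h i _ ih

theorem BrMon.comm {m : ℕ} {i j : Fin m} (h : BrFar i j) (x : BrMon m) :
    s i * (s j * x) = s j * (s i * x) := by
  obtain ⟨l, rfl⟩ := w_surj x
  exact w_eq.2 (ReflTransGen.single (.comm h l))

theorem BrMon.braid {m : ℕ} {i j : Fin m} (h : BrAdj i j) (x : BrMon m) :
    s i * (s j * (s i * x)) = s j * (s i * (s j * x)) := by
  obtain ⟨l, rfl⟩ := w_surj x
  exact w_eq.2 (ReflTransGen.single (.braid h l))

/-- Lifting to monoids. -/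
def BrMon.lift {m : ℕ} {N : Type*} [Monoid N] (f : Fin m → N)
    (h1 : ∀ i j, BrFar i j → f i * f j = f j * f i)
    (h2 : ∀ i j, BrAdj i j → f i * f j * f i = f j * f i * f j) : BrMon m →* N :=
  Con.lift (brCon m) (FreeMonoid.lift f) (by
    intro a b h
    change ReflTransGen BrStep (FreeMonoid.toList a) (FreeMonoid.toList b) at h
    change FreeMonoid.lift f a = FreeMonoid.lift f b
    rw [FreeMonoid.lift_apply, FreeMonoid.lift_apply]
    generalize FreeMonoid.toList a = a at h ⊢
    generalize FreeMonoid.toList b = b at h ⊢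
    induction h with
    | refl => rfl
    | tail hh hs ih =>
      rw [ih]
      clear ih hh
      induction hs with
      | cons i _ ih => simp only [List.map_cons, List.prod_cons, ih]
      | comm h l => simp only [List.map_cons, List.prod_cons, ← mul_assoc, h1 _ _ h]
      | braid h l => simp only [List.map_cons, List.prod_cons, ← mul_assoc, h2 _ _ h])

theorem BrMon.lift_s {m : ℕ} {N : Type*} [Monoid N] (f : Fin m → N) (h1 h2) (i : Fin m) :
    BrMon.lift f h1 h2 (s i) = f i := by
  change FreeMonoid.lift f (FreeMonoid.of i) = f i
  simp

def BrMon.lenHom (m : ℕ) : BrMon m →* Multiplicative ℕ :=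
  BrMon.lift (fun _ => Multiplicative.ofAdd 1) (by simp) (by simp)

def BrMon.len {m : ℕ} (x : BrMon m) : ℕ := Multiplicative.toAdd (BrMon.lenHom m x)

theorem BrMon.len_mul {m : ℕ} (x y : BrMon m) : len (x * y) = len x + len y := by
  simp [len]
theorem BrMon.len_s {m : ℕ} (i : Fin m) : len (s i) = 1 := by
  simp [len, lenHom, lift_s]
theorem BrMon.len_one {m : ℕ} : len (1 : BrMon m) = 0 := by
  simp [len]
theorem BrMon.len_w {m : ℕ} (l : List (Fin m)) : len (w l) = l.length := by
  induction l with
  | nil => exact len_one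
  | cons a l ih => rw [w_cons, len_mul, ih, len_s]; simp; omega

/-- Anti-automorphism. -/
def BrMon.rev {m : ℕ} : BrMon m →* (BrMon m)ᵐᵒᵖ :=
  BrMon.lift (fun i => MulOpposite.op (s i))
    (by
      intro i j h
      rw [← MulOpposite.op_mul, ← MulOpposite.op_mul]
      have := comm h 1
      simp only [mul_one] at this
      rw [this])
    (by
      intro i j h
      simp only [← MulOpposite.op_mul]
      have := braid h 1
      simp only [mul_one] at this
      rw [this])

def BrMon.r {m : ℕ} (x : BrMon m) : BrMon m := MulOpposite.unop (rev x)
theorem BrMon.r_mul {m : ℕ} (x y : BrMon m) : r (x * y) = r y * r x := by simp [r]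
theorem BrMon.r_s {m : ℕ} (i : Fin m) : r (s i) = s i := by simp [r, rev, lift_s]
theorem BrMon.r_one {m : ℕ} : r (1 : BrMon m) = 1 := by simp [r]
theorem BrMon.r_r {m : ℕ} (x : BrMon m) : r (r x) = x := by
  induction x using BrMon.ind with
  | h1 => simp [r_one]
  | h i x ih => rw [r_mul, r_mul, ih, r_s, r_s]

theorem br_cases {m : ℕ} (i j : Fin m) : i = j ∨ BrFar i j ∨ BrAdj i j := by
  unfold BrFar BrAdj
  rcases eq_or_ne i j with h | h
  · exact Or.inl h
  · have : (i : ℕ) ≠ j := fun h' => h (Fin.ext h')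
    omega

/-- `s i * x` and `s j * y` being equal is explained by the least common multiple. -/
def BrLcm {m : ℕ} (i j : Fin m) (x y : BrMon m) : Prop :=
  (i = j ∧ x = y) ∨ (BrFar i j ∧ ∃ z, x = s j * z ∧ y = s i * z) ∨
  (BrAdj i j ∧ ∃ z, x = s j * (s i * z) ∧ y = s i * (s j * z))

theorem BrLcm.eq {m : ℕ} {i : Fin m} {x y : BrMon m} (h : BrLcm i i x y) : x = y := by
  rcases h with ⟨_, h⟩ | ⟨h, _⟩ | ⟨h, _⟩
  · exact h
  · unfold BrFar at h; omega
  · unfold BrAdj at h; omega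

theorem BrLcm.far {m : ℕ} {i j : Fin m} {x y : BrMon m} (h : BrLcm i j x y) (hf : BrFar i j) :
    ∃ z, x = s j * z ∧ y = s i * z := by
  rcases h with ⟨h', _⟩ | ⟨_, h⟩ | ⟨h, _⟩
  · subst h'; unfold BrFar at hf; omega
  · exact h
  · unfold BrAdj at h; unfold BrFar at hf; omega

theorem BrLcm.adj {m : ℕ} {i j : Fin m} {x y : BrMon m} (h : BrLcm i j x y) (hf : BrAdj i j) :
    ∃ z, x = s j * (s i * z) ∧ y = s i * (s j * z) := by
  rcases h with ⟨h', _⟩ | ⟨h, _⟩ | ⟨_, h⟩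
  · subst h'; unfold BrAdj at hf; omega
  · unfold BrFar at h; unfold BrAdj at hf; omega
  · exact h

theorem garside_step_far {m : ℕ} {N : ℕ}
    (IH : ∀ (i j : Fin m) x y, len x < N → s i * x = s j * y → BrLcm i j x y)
    {i k j : Fin m} {x t r : BrMon m} (hN : len t ≤ N) (h : BrLcm i k x t) (hjk : BrFar j k)
    (ht : t = s j * r) : BrLcm i j x (s k * r) := by
  rcases h with ⟨rfl, rfl⟩ | ⟨hik, z, rfl, rfl⟩ | ⟨hik, z, rfl, rfl⟩
  · exact Or.inr (Or.inl ⟨hjk.symm, r, ht, rfl⟩)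
  · have hl := congrArg len ht
    simp only [len_mul, len_s] at hl hN
    rcases IH i j z r (by omega) ht with ⟨rfl, rfl⟩ | ⟨hij, u, rfl, rfl⟩ | ⟨hij, u, rfl, rfl⟩
    · exact Or.inl ⟨rfl, rfl⟩
    · exact Or.inr (Or.inl ⟨hij, s k * u, comm hjk.symm u, comm hik.symm u⟩)
    · refine Or.inr (Or.inr ⟨hij, s k * u, ?_, ?_⟩)
      · rw [comm hjk.symm, comm hik.symm]
      · rw [comm hik.symm, comm hjk.symm]
  · have hl := congrArg len ht
    simp only [len_mul, len_s] at hl hN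
    rcases IH i j _ r (by simp only [len_mul, len_s]; omega) ht with
      ⟨rfl, _⟩ | ⟨hij, u, h1, rfl⟩ | ⟨hij, u, h1, rfl⟩
    · unfold BrAdj at hik; unfold BrFar at hjk; omega
    · obtain ⟨v, rfl, rfl⟩ := (IH k j z u (by omega) h1).far hjk.symm
      refine Or.inr (Or.inl ⟨hij, s k * (s i * v), ?_, ?_⟩)
      · rw [comm hij, comm hjk.symm]
      · rw [braid hik]
    · have hl1 := congrArg len h1
      simp only [len_mul, len_s] at hl1 hl hN
      obtain ⟨v, rfl, h2⟩ := (IH k j z _ (by omega) h1).far hjk.symm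
      simp only [len_mul, len_s] at hl1 hl hN
      obtain ⟨u', rfl, rfl⟩ := (IH i k _ _ (by omega) h2).adj hik
      refine Or.inr (Or.inr ⟨hij, s k * (s i * (s j * u')), ?_, ?_⟩)
      · rw [braid hij, comm hjk.symm, comm hjk u', braid hik.symm]
      · rw [comm hjk (s i * u'), braid hik.symm, braid hij, comm hjk.symm]

theorem garside_step_adj {m : ℕ} {N : ℕ}
    (IH : ∀ (i j : Fin m) x y, len x < N → s i * x = s j * y → BrLcm i j x y)
    {i k j : Fin m} {x t r : BrMon m} (hN : len t ≤ N) (h : BrLcm i k x t) (hjk : BrAdj j k)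
    (ht : t = s j * (s k * r)) : BrLcm i j x (s k * (s j * r)) := by
  rcases h with ⟨rfl, rfl⟩ | ⟨hik, z, rfl, rfl⟩ | ⟨hik, z, rfl, rfl⟩
  · exact Or.inr (Or.inr ⟨hjk.symm, r, ht, rfl⟩)
  · have hl := congrArg len ht
    simp only [len_mul, len_s] at hl hN
    rcases IH i j z _ (by omega) ht with ⟨rfl, _⟩ | ⟨hij, u, rfl, h1⟩ | ⟨hij, u, rfl, h1⟩
    · unfold BrAdj at hjk; unfold BrFar at hik; omega
    · simp only [len_mul, len_s] at hl hN
      obtain ⟨v, rfl, rfl⟩ := (IH k i r u (by omega) h1).far hik.symm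
      refine Or.inr (Or.inl ⟨hij, s k * (s j * v), ?_, ?_⟩)
      · rw [braid hjk]
      · rw [comm hij.symm, comm hik.symm]
    · simp only [len_mul, len_s] at hl hN
      obtain ⟨v, rfl, h2⟩ := (IH k i r _ (by omega) h1).far hik.symm
      simp only [len_mul, len_s] at hl hN
      obtain ⟨u', rfl, rfl⟩ := (IH j k _ _ (by omega) h2).adj hjk
      refine Or.inr (Or.inr ⟨hij, s k * (s j * (s i * u')), ?_, ?_⟩)
      · rw [comm hik (s j * u'), braid hjk.symm, braid hij.symm, comm hik.symm]
      · rw [braid hij.symm, comm hik.symm, comm hik u', braid hjk.symm]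
  · have hl := congrArg len ht
    simp only [len_mul, len_s] at hl hN
    rcases IH i j _ _ (by simp only [len_mul, len_s]; omega) ht with
      ⟨rfl, h1⟩ | ⟨hij, u, h1, h2⟩ | ⟨hij, _⟩
    · obtain rfl := (IH k k _ _ (by omega) h1).eq
      exact Or.inl ⟨rfl, rfl⟩
    · obtain ⟨v, rfl, rfl⟩ := (IH k j _ _ (by omega) h1).adj hjk.symm
      simp only [len_mul, len_s] at hl hN
      obtain ⟨v', rfl, h3⟩ := (IH k i _ _ (by omega) h2).adj hik.symm
      simp only [len_mul, len_s] at hl hN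
      have h4 := (IH k k _ _ (by simp only [len_mul, len_s]; omega) h3).eq
      obtain ⟨y, rfl, rfl⟩ := (IH j i _ _ (by omega) h4).far hij.symm
      refine Or.inr (Or.inl ⟨hij, s k * (s j * (s i * (s k * y))), ?_, ?_⟩)
      · rw [comm hij, braid hik, braid hjk.symm]
      · rw [comm hij.symm (s k * (s j * y)), braid hjk, braid hik.symm, comm hij]
    · unfold BrAdj at *; omega

theorem garside {m : ℕ} : ∀ (N : ℕ) (i j : Fin m) (x y : BrMon m), len x < N →
    s i * x = s j * y → BrLcm i j x y := by
  intro N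
  induction N with
  | zero => intro i j x y h; omega
  | succ N IH =>
    intro i j x y hN hxy
    obtain ⟨lx, rfl⟩ := w_surj x
    obtain ⟨ly, rfl⟩ := w_surj y
    rw [← w_cons, ← w_cons, w_eq] at hxy
    have key : ∀ l, ReflTransGen BrStep (i :: lx) l → ∀ j ly, l = j :: ly →
        BrLcm i j (w lx) (w ly) := by
      intro l hl
      induction hl with
      | refl =>
        intro j ly h
        obtain ⟨rfl, rfl⟩ := List.cons.inj h
        exact Or.inl ⟨rfl, rfl⟩
      | @tail b c hb hs ih =>
        intro j ly h
        subst h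
        have hlen := congrArg len (w_eq.2 hb)
        simp only [w_cons, len_mul, len_s] at hlen
        cases hs with
        | cons _ hs =>
          have h1 := ih _ _ rfl
          rwa [w_eq.2 (ReflTransGen.single hs)] at h1
        | comm h l =>
          simp only [w_cons, len_mul, len_s] at hlen
          exact garside_step_far (r := w l) IH (by simp only [w_cons, len_mul, len_s]; omega)
            (ih _ _ rfl) h.symm rfl
        | braid h l =>
          simp only [w_cons, len_mul, len_s] at hlen
          exact garside_step_adj (r := w l) IH (by simp only [w_cons, len_mul, len_s]; omega)
            (ih _ _ rfl) h.symm rfl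
    exact key _ hxy _ _ rfl

theorem BrMon.lcm_left {m : ℕ} {i j : Fin m} {x y : BrMon m} (h : s i * x = s j * y) :
    BrLcm i j x y := garside _ i j x y (Nat.lt_succ_self _) h

theorem BrMon.cancel_left {m : ℕ} (a : BrMon m) {x y : BrMon m} (h : a * x = a * y) : x = y := by
  induction a using BrMon.ind with
  | h1 => simpa using h
  | h i a ih =>
    rw [mul_assoc, mul_assoc] at h
    exact ih (lcm_left h).eq

theorem BrMon.lcm_right_eq {m : ℕ} {i : Fin m} {x y : BrMon m} (h : x * s i = y * s i) :
    x = y := by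
  have := congrArg r h
  rw [r_mul, r_mul, r_s] at this
  have := congrArg r (lcm_left this).eq
  rwa [r_r, r_r] at this

theorem BrMon.lcm_right_far {m : ℕ} {i j : Fin m} {x y : BrMon m} (h : x * s i = y * s j)
    (hf : BrFar i j) : ∃ z, x = z * s j ∧ y = z * s i := by
  have := congrArg r h
  rw [r_mul, r_mul, r_s, r_s] at this
  obtain ⟨z, h1, h2⟩ := (lcm_left this).far hf
  refine ⟨r z, ?_, ?_⟩
  · rw [← r_r x, h1, r_mul, r_s]
  · rw [← r_r y, h2, r_mul, r_s]

theorem BrMon.lcm_right_adj {m : ℕ} {i j : Fin m} {x y : BrMon m} (h : x * s i = y * s j)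
    (hf : BrAdj i j) : ∃ z, x = z * s i * s j ∧ y = z * s j * s i := by
  have := congrArg r h
  rw [r_mul, r_mul, r_s, r_s] at this
  obtain ⟨z, h1, h2⟩ := (lcm_left this).adj hf
  refine ⟨r z, ?_, ?_⟩
  · rw [← r_r x, h1, r_mul, r_mul, r_s, r_s]
  · rw [← r_r y, h2, r_mul, r_mul, r_s, r_s]

theorem BrMon.finite_dvd {m : ℕ} (x : BrMon m) : Finite {u : BrMon m // u ∣ x} := by
  have h1 : {l : List (Fin m) | l.length ≤ len x}.Finite := List.finite_length_le _ _
  have h2 := h1.image (w (m := m))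
  refine Set.Finite.subset h2 ?_
  rintro u ⟨t, rfl⟩
  obtain ⟨l, rfl⟩ := w_surj u
  exact ⟨l, by simp [len_mul, len_w], rfl⟩

open BrMon

theorem BrMon.cancel_right {m : ℕ} (a : BrMon m) {x y : BrMon m} (h : x * a = y * a) : x = y := by
  have := congrArg r h
  rw [r_mul, r_mul] at this
  have := congrArg r (cancel_left _ this)
  rwa [r_r, r_r] at this

/-- Generators indexed by natural numbers. -/
def BrMon.S (m k : ℕ) : BrMon m := if h : k < m then s ⟨k, h⟩ else 1

theorem BrMon.S_comm {m i j : ℕ} (h : i + 1 < j) : S m i * S m j = S m j * S m i := by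
  unfold S
  split_ifs with h1 h2 h2
  · have := comm (m := m) (i := ⟨i, h1⟩) (j := ⟨j, h2⟩) (Or.inl h) 1
    simpa using this
  all_goals simp

theorem BrMon.S_braid {m i : ℕ} (h : i + 1 < m) :
    S m i * S m (i+1) * S m i = S m (i+1) * S m i * S m (i+1) := by
  unfold S
  rw [dif_pos h, dif_pos (by omega : i < m)]
  have := braid (m := m) (i := ⟨i, by omega⟩) (j := ⟨i+1, h⟩) (Or.inl rfl) 1
  simpa [mul_assoc] using this

def BrMon.D (m : ℕ) : ℕ → BrMon m
  | 0 => 1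
  | k + 1 => D m k * S m k

def BrMon.D' (m : ℕ) : ℕ → BrMon m
  | 0 => 1
  | k + 1 => D' m k * S m (k+1)

theorem BrMon.D_eq (m k : ℕ) : D m (k+1) = S m 0 * D' m k := by
  induction k with
  | zero => simp [D, D']
  | succ k ih => rw [D, ih, D', mul_assoc]

theorem BrMon.S_D_comm {m k j : ℕ} (h : k + 1 ≤ j) : S m j * D m k = D m k * S m j := by
  induction k with
  | zero => simp [D]
  | succ k ih => rw [D, ← mul_assoc, ih (by omega), mul_assoc, mul_assoc, ← S_comm (by omega)]

theorem BrMon.D_shift {m k i : ℕ} (h : i + 1 < k) (hk : k ≤ m) :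
    D m k * S m i = S m (i+1) * D m k := by
  induction k with
  | zero => omega
  | succ k ih =>
    rcases Nat.lt_or_ge (i+1) k with h1 | h1
    · rw [D, mul_assoc, ← S_comm h1, ← mul_assoc, ih h1 (by omega), mul_assoc]
    · obtain rfl : k = i + 1 := by omega
      rw [D, D]
      calc D m i * S m i * S m (i+1) * S m i = D m i * (S m i * S m (i+1) * S m i) := by
            simp only [mul_assoc]
        _ = (D m i * S m (i+1)) * S m i * S m (i+1) := by
            rw [S_braid (by omega)]; simp only [mul_assoc]
        _ = _ := by rw [← S_D_comm (by omega)]; simp only [mul_assoc]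

theorem BrMon.D_D' {m k : ℕ} (h : k + 1 ≤ m) : D m m * D m k = D' m k * D m m := by
  induction k with
  | zero => simp [D, D']
  | succ k ih =>
    rw [D, D', ← mul_assoc, ih (by omega), mul_assoc, D_shift (by omega) le_rfl, mul_assoc]

theorem BrMon.D_sq {m : ℕ} : S (m+1) 0 * (D (m+1) (m+1) * D (m+1) (m+1)) =
    D (m+1) (m+1) * D (m+1) (m+1) * S (m+1) m := by
  calc S (m+1) 0 * (D (m+1) (m+1) * D (m+1) (m+1))
      = S (m+1) 0 * (D (m+1) (m+1) * D (m+1) m * S (m+1) m) := by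
        conv_lhs => rw [D]
        simp only [D, mul_assoc]
    _ = (S (m+1) 0 * D' (m+1) m) * D (m+1) (m+1) * S (m+1) m := by
        rw [D_D' le_rfl]; simp only [mul_assoc]
    _ = _ := by rw [← D_eq]

theorem BrMon.D_pow_shift {m j : ℕ} (h : j < m) : D m m ^ j * S m 0 = S m j * D m m ^ j := by
  induction j with
  | zero => simp
  | succ j ih =>
    rw [pow_succ', mul_assoc, ih (by omega), ← mul_assoc, D_shift h le_rfl, mul_assoc]

def BrMon.z (m : ℕ) : BrMon m := D m m ^ (m+1)

theorem BrMon.z_S {m j : ℕ} (h : j < m) : S m j * z m = z m * S m j := by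
  induction j with
  | zero =>
    obtain ⟨m, rfl⟩ : ∃ k, m = k + 1 := ⟨m - 1, by omega⟩
    have e : z (m+1) = D (m+1) (m+1) * D (m+1) (m+1) * D (m+1) (m+1) ^ m := by
      rw [z, pow_succ', pow_succ', mul_assoc]
    rw [e, ← mul_assoc, D_sq, mul_assoc, ← D_pow_shift (by omega)]
    simp only [mul_assoc]
  | succ j ih =>
    have ih := ih (by omega)
    have c : D m m * z m = z m * D m m := by
      rw [z, ← pow_succ, ← pow_succ']
    apply cancel_right (D m m)
    rw [mul_assoc, ← c, ← mul_assoc, ← D_shift h le_rfl, mul_assoc, ih, ← mul_assoc, c, mul_assoc,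
      D_shift h le_rfl, mul_assoc]

theorem BrMon.z_comm {m : ℕ} (x : BrMon m) : x * z m = z m * x := by
  induction x using BrMon.ind with
  | h1 => simp
  | h i x ih =>
    have := z_S i.2
    simp only [S, i.2, dif_pos] at this
    rw [mul_assoc, ih, ← mul_assoc, this, mul_assoc]

theorem BrMon.zpow_comm {m : ℕ} (x : BrMon m) (k : ℕ) : x * z m ^ k = z m ^ k * x :=
  (show Commute x (z m) from z_comm x).pow_right k

theorem BrMon.s_dvd_z {m : ℕ} (i : Fin m) : s i ∣ z m := by
  obtain ⟨m, rfl⟩ : ∃ k, m = k + 1 := ⟨m - 1, by have := i.2; omega⟩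
  have h1 : s i ∣ D (m+1) (m+1) ^ ((i : ℕ) + 1) := by
    rw [pow_succ]
    nth_rewrite 2 [D_eq]
    rw [← mul_assoc, D_pow_shift i.2, S, dif_pos i.2, mul_assoc]
    exact Dvd.intro _ rfl
  exact h1.trans (pow_dvd_pow _ (by have := i.2; omega))

theorem BrMon.dvd_zpow {m : ℕ} (x : BrMon m) : ∃ k, x ∣ z m ^ k := by
  induction x using BrMon.ind with
  | h1 => exact ⟨0, by simp⟩
  | h i x ih =>
    obtain ⟨k, y, hy⟩ := ih
    obtain ⟨t, ht⟩ := s_dvd_z i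
    refine ⟨k+1, y * t, ?_⟩
    rw [← mul_assoc, mul_assoc (s i), ← hy, zpow_comm, mul_assoc, ← ht, pow_succ]

theorem BrMon.common {m : ℕ} (x y : BrMon m) : ∃ w, x ∣ w ∧ y ∣ w := by
  obtain ⟨k, hk⟩ := dvd_zpow x
  obtain ⟨l, hl⟩ := dvd_zpow y
  exact ⟨z m ^ (k + l), hk.trans (pow_dvd_pow _ (by omega)), hl.trans (pow_dvd_pow _ (by omega))⟩

theorem braid_rel_far {n : ℕ} (i j : Fin (n-1)) (h : (i:ℕ) + 1 < j) :
    (PresentedGroup.of i * PresentedGroup.of j : BraidGroup n) =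
      PresentedGroup.of j * PresentedGroup.of i := by
  have : PresentedGroup.mk (braidRels n) (FreeGroup.of i * FreeGroup.of j * (FreeGroup.of i)⁻¹ *
      (FreeGroup.of j)⁻¹) = 1 :=
    (QuotientGroup.eq_one_iff _).2 (Subgroup.subset_normalClosure (Or.inl ⟨i, j, h, rfl⟩))
  rw [map_mul, map_mul, map_mul, map_inv, map_inv, mul_inv_eq_one, mul_inv_eq_iff_eq_mul] at this
  exact this

theorem braid_rel_adj {n : ℕ} (i j : Fin (n-1)) (h : (i:ℕ) + 1 = j) :
    (PresentedGroup.of i * PresentedGroup.of j * PresentedGroup.of i : BraidGroup n) =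
      PresentedGroup.of j * PresentedGroup.of i * PresentedGroup.of j := by
  have : PresentedGroup.mk (braidRels n) (FreeGroup.of i * FreeGroup.of j * FreeGroup.of i *
      (FreeGroup.of j * FreeGroup.of i * FreeGroup.of j)⁻¹) = 1 :=
    (QuotientGroup.eq_one_iff _).2 (Subgroup.subset_normalClosure (Or.inr ⟨i, j, h, rfl⟩))
  rw [map_mul, map_inv, mul_inv_eq_one, map_mul, map_mul, map_mul, map_mul] at this
  exact this

/-- The canonical map from positive braids to braids. -/
def brPi (n : ℕ) : BrMon (n-1) →* BraidGroup n :=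
  BrMon.lift (fun i => PresentedGroup.of i)
    (by
      rintro i j (h | h)
      · exact braid_rel_far i j h
      · exact (braid_rel_far j i h).symm)
    (by
      rintro i j (h | h)
      · exact braid_rel_adj i j h
      · exact (braid_rel_adj j i h).symm)

theorem brPi_s (n : ℕ) (i : Fin (n-1)) : brPi n (s i) = PresentedGroup.of i := lift_s _ _ _ i

/-- The braid represented by a word. -/
def brW (n : ℕ) (L : List (Fin (n-1) × Bool)) : BraidGroup n :=
  PresentedGroup.mk (braidRels n) (FreeGroup.mk L)

theorem brW_append (n : ℕ) (L L') : brW n (L ++ L') = brW n L * brW n L' := by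
  rw [brW, ← FreeGroup.mul_mk, map_mul]; rfl

theorem brW_nil (n : ℕ) : brW n [] = 1 := map_one _

theorem brW_pos (n : ℕ) (i) : brW n [(i, true)] = PresentedGroup.of i := rfl

theorem brW_neg (n : ℕ) (i) : brW n [(i, false)] = (PresentedGroup.of i)⁻¹ := by
  rw [← brW_pos, brW, brW, ← map_inv]; rfl

theorem brW_surj (n : ℕ) (g : BraidGroup n) : ∃ L, brW n L = g := by
  obtain ⟨x, rfl⟩ := PresentedGroup.mk_surjective _ g
  exact ⟨x.toWord, by rw [brW, FreeGroup.mk_toWord]⟩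

theorem braid_fraction (n : ℕ) (g : BraidGroup n) :
    ∃ k b, brPi n (z (n-1) ^ k) * g = brPi n b := by
  obtain ⟨L, rfl⟩ := brW_surj n g
  induction L with
  | nil => exact ⟨0, 1, by simp [brW_nil]⟩
  | cons p L ih =>
    obtain ⟨k, b, h⟩ := ih
    obtain ⟨i, e⟩ := p
    have e1 : brW n ((i, e) :: L) = brW n [(i, e)] * brW n L := brW_append n [(i, e)] L
    rw [e1]
    cases e with
    | true =>
      refine ⟨k, s i * b, ?_⟩
      rw [brW_pos, ← brPi_s, ← mul_assoc, ← map_mul, ← zpow_comm, map_mul, mul_assoc, h, map_mul]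
    | false =>
      obtain ⟨t, ht⟩ := s_dvd_z i
      have ht' : z (n-1) = t * s i := by
        apply cancel_left (s i)
        rw [z_comm, ← mul_assoc, ← ht]
      refine ⟨k+1, t * b, ?_⟩
      rw [brW_neg, ← brPi_s, pow_succ]
      nth_rewrite 2 [ht']
      rw [← mul_assoc (z (n-1) ^ k), ← zpow_comm, map_mul _ _ (s i), mul_assoc,
        mul_inv_cancel_left, map_mul, mul_assoc, h, map_mul]

/-- Property A. -/
def brRep (n : ℕ) : BraidGroup n →* MulAut (FreeGroup ℕ) :=
  PresentedGroup.toGroup (f := fun i : Fin (n-1) => brAut i) (by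
    rintro r (⟨i, j, h, rfl⟩ | ⟨i, j, h, rfl⟩)
    · simp only [map_mul, map_inv, FreeGroup.lift_apply_of]
      rw [brAut_comm _ _ h]; group
    · simp only [map_mul, map_inv, FreeGroup.lift_apply_of]
      rw [← h, brAut_braid]; group)

theorem brRep_of (n : ℕ) (i : Fin (n-1)) : brRep n (PresentedGroup.of i) = brAut i :=
  PresentedGroup.toGroup.of _

theorem brAut_fix (i j : ℕ) (h : i < j) : brAut j (FreeGroup.of i)⁻¹ = (FreeGroup.of i)⁻¹ := by
  rw [map_inv, brAut_apply, brF_other _ _ (by omega) (by omega)]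

theorem brE_start (i : ℕ) : BrE (i, false) (FreeGroup.of i)⁻¹ := by
  simp [BrE, FreeGroup.toWord_inv, FreeGroup.invRev]

theorem brRep_word (n : ℕ) (i : Fin (n-1)) (L : List (Fin (n-1) × Bool))
    (h1 : ∀ p ∈ L, i ≤ p.1) (h2 : ∀ p ∈ L, p.1 = i → p.2 = true) :
    ((∀ p ∈ L, p.1 ≠ i) ∧ brRep n (brW n L) (FreeGroup.of (i:ℕ))⁻¹ = (FreeGroup.of (i:ℕ))⁻¹) ∨
    BrE (i, true) (brRep n (brW n L) (FreeGroup.of (i:ℕ))⁻¹) := by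
  induction L with
  | nil => left; simp [brW_nil]
  | cons p L ih =>
    have ih := ih (fun p hp => h1 p (List.mem_cons_of_mem _ hp))
      (fun p hp => h2 p (List.mem_cons_of_mem _ hp))
    obtain ⟨j, e⟩ := p
    have e1 : brW n ((j, e) :: L) = brW n [(j, e)] * brW n L := brW_append n [(j, e)] L
    rw [e1, map_mul, MulAut.mul_apply]
    have hij : i ≤ j := h1 (j, e) (by simp)
    rcases eq_or_ne j i with rfl | hne
    · have : e = true := h2 (j, e) (by simp) rfl
      subst this
      right
      rw [brW_pos, brRep_of, brAut_E_self]
      rcases ih with ⟨_, ih⟩ | ih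
      · rw [ih]; exact Or.inr (Or.inl (brE_start _))
      · exact Or.inl ih
    · have hlt : (i : ℕ) < j := lt_of_le_of_ne hij (fun h => hne (Fin.ext h.symm))
      rcases ih with ⟨ih1, ih⟩ | ih
      · left
        refine ⟨?_, ?_⟩
        · intro p hp
          rcases List.mem_cons.1 hp with rfl | hp
          · exact hne
          · exact ih1 p hp
        · rw [ih]
          cases e with
          | true => rw [brW_pos, brRep_of, brAut_fix _ _ hlt]
          | false =>
            rw [brW_neg, map_inv (brRep n), brRep_of, MulAut.inv_apply, MulEquiv.symm_apply_eq,
              brAut_fix _ _ hlt]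
      · right
        cases e with
        | true => rw [brW_pos, brRep_of, brAut_E_other _ _ hlt]; exact ih
        | false =>
          rw [brW_neg, map_inv, brRep_of, ← brAut_E_other _ _ hlt, MulAut.apply_inv_self]
          exact ih

theorem one_notMem_pos (n : ℕ) : (1 : BraidGroup n) ∉ DehornoyPos n := by
  rintro ⟨L, hL, i, ⟨p, hp, hpi⟩, h1, h2⟩
  change brW n L = 1 at hL
  rcases brRep_word n i L h1 h2 with ⟨h, _⟩ | h
  · exact h p hp hpi
  · rw [hL, map_one] at h
    have := brE_excl h (brE_start i)
    simp at this

/-- The labelled graph of left divisors of a positive braid. -/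
def brGr {m : ℕ} (x : BrMon m) (i : ℕ) (u v : {u : BrMon m // u ∣ x}) : Prop :=
  ∃ h : i < m, v.1 = u.1 * s ⟨i, h⟩

theorem brGr_R {n : ℕ} {x : BrMon (n-1)} {i : ℕ} {u v} (h : BrR (brGr x) i u v) :
    ∃ L : List (Fin (n-1) × Bool), brPi n u.1 * brW n L = brPi n v.1 ∧
      (∀ p ∈ L, i ≤ p.1) ∧ (∀ p ∈ L, (p.1 : ℕ) = i → p.2 = true) := by
  induction h with
  | refl => exact ⟨[], by simp [brW_nil], by simp, by simp⟩
  | tail _ hs ih =>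
    obtain ⟨L, h0, h1, h2⟩ := ih
    rcases hs with ⟨hi, hs⟩ | ⟨j, hj, ⟨hi, hs⟩ | ⟨hi, hs⟩⟩
    · refine ⟨L ++ [(⟨i, hi⟩, true)], ?_, ?_, ?_⟩
      · rw [brW_append, ← mul_assoc, h0, hs, map_mul, brW_pos, brPi_s]
      · intro p hp
        rcases List.mem_append.1 hp with hp | hp
        · exact h1 p hp
        · simp at hp; subst hp; exact le_rfl
      · intro p hp
        rcases List.mem_append.1 hp with hp | hp
        · exact h2 p hp
        · simp at hp; subst hp; simp
    · refine ⟨L ++ [(⟨j, hi⟩, true)], ?_, ?_, ?_⟩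
      · rw [brW_append, ← mul_assoc, h0, hs, map_mul, brW_pos, brPi_s]
      · intro p hp
        rcases List.mem_append.1 hp with hp | hp
        · exact h1 p hp
        · simp at hp; subst hp; exact hj.le
      · intro p hp
        rcases List.mem_append.1 hp with hp | hp
        · exact h2 p hp
        · simp at hp; subst hp; simp
    · refine ⟨L ++ [(⟨j, hi⟩, false)], ?_, ?_, ?_⟩
      · rw [brW_append, ← mul_assoc, h0, hs, map_mul, brW_neg, brPi_s, mul_inv_cancel_right]
      · intro p hp
        rcases List.mem_append.1 hp with hp | hp
        · exact h1 p hp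
        · simp at hp; subst hp; exact hj.le
      · intro p hp
        rcases List.mem_append.1 hp with hp | hp
        · exact h2 p hp
        · simp at hp; subst hp; intro h; simp at h; omega

theorem brGr_P {n : ℕ} {x : BrMon (n-1)} {i : ℕ} {u v} (h : BrP (brGr x) i u v) :
    (brPi n u.1)⁻¹ * brPi n v.1 ∈ DehornoyPos n := by
  obtain ⟨a, b, h1, ⟨hi, h2⟩, h3⟩ := h
  obtain ⟨L, e1, e2, e3⟩ := brGr_R h1
  obtain ⟨L', f1, f2, f3⟩ := brGr_R h3
  refine ⟨L ++ ([(⟨i, hi⟩, true)] ++ L'), ?_, ⟨i, hi⟩, ?_, ?_, ?_⟩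
  · change brW n _ = _
    rw [eq_inv_mul_iff_mul_eq, brW_append, brW_append, ← mul_assoc, e1, ← mul_assoc, brW_pos,
      ← brPi_s, ← map_mul, ← h2, f1]
  · exact ⟨(⟨i, hi⟩, true), by simp, rfl⟩
  · intro p hp
    rcases List.mem_append.1 hp with hp | hp
    · exact e2 p hp
    rcases List.mem_append.1 hp with hp | hp
    · simp at hp; subst hp; exact le_rfl
    · exact f2 p hp
  · intro p hp hpi
    have hpi' : (p.1 : ℕ) = i := by rw [hpi]
    rcases List.mem_append.1 hp with hp | hp
    · exact e3 p hp hpi'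
    rcases List.mem_append.1 hp with hp | hp
    · simp at hp; subst hp; rfl
    · exact f3 p hp hpi'

theorem brGr_graph (n : ℕ) (x : BrMon (n-1)) : BrGraph (n-1) (brGr x) where
  u0 := by
    rintro i u v v' ⟨h, e⟩ ⟨h', e'⟩
    exact Subtype.ext (e.trans e'.symm)
  d0 := by
    rintro i u v v' ⟨h, e⟩ ⟨h', e'⟩
    exact Subtype.ext (lcm_right_eq (e.symm.trans e'))
  u1 := by
    rintro i ⟨u, hu⟩ ⟨v, hv⟩ ⟨v', hv'⟩ ⟨h, e⟩ ⟨h', e'⟩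
    dsimp only at e e'
    have hadj : BrAdj (⟨i, h⟩ : Fin (n-1)) ⟨i+1, h'⟩ := Or.inl rfl
    obtain ⟨t, ht⟩ := hv
    obtain ⟨t', ht'⟩ := hv'
    have q : u * (s ⟨i, h⟩ * t) = u * (s ⟨i+1, h'⟩ * t') := by
      rw [← mul_assoc, ← mul_assoc, ← e, ← e', ← ht, ← ht']
    obtain ⟨y, rfl, rfl⟩ := (lcm_left (cancel_left _ q)).adj hadj
    refine ⟨⟨v * s ⟨i+1, h'⟩, ⟨s ⟨i, h⟩ * y, ?_⟩⟩,
      ⟨v * s ⟨i+1, h'⟩ * s ⟨i, h⟩, ⟨y, ?_⟩⟩, ⟨v' * s ⟨i, h⟩, ⟨s ⟨i+1, h'⟩ * y, ?_⟩⟩,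
      ⟨h', rfl⟩, ⟨h, rfl⟩, ⟨h, rfl⟩, ⟨h', ?_⟩⟩
    · rw [ht]; simp only [mul_assoc]
    · rw [ht]; simp only [mul_assoc]
    · rw [ht']; simp only [mul_assoc]
    · subst e e'
      have := braid hadj 1
      simp only [mul_one] at this
      simp only [mul_assoc, this]
  d1 := by
    rintro i ⟨u, hu⟩ ⟨v, hv⟩ ⟨v', hv'⟩ ⟨h, e⟩ ⟨h', e'⟩
    dsimp only at e e'
    have hadj : BrAdj (⟨i, h⟩ : Fin (n-1)) ⟨i+1, h'⟩ := Or.inl rfl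
    obtain ⟨y, rfl, rfl⟩ := lcm_right_adj (e.symm.trans e') hadj
    exact ⟨⟨y * s ⟨i, h⟩, (Dvd.intro _ rfl).trans hv⟩,
      ⟨y, (Dvd.intro _ (mul_assoc _ _ _).symm).trans hv⟩,
      ⟨y * s ⟨i+1, h'⟩, (Dvd.intro _ rfl).trans hv'⟩, ⟨h', rfl⟩, ⟨h, rfl⟩, ⟨h, rfl⟩, ⟨h', rfl⟩⟩
  u2 := by
    rintro i j ⟨u, hu⟩ ⟨v, hv⟩ ⟨v', hv'⟩ hij ⟨h, e⟩ ⟨h', e'⟩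
    dsimp only at e e'
    have hfar : BrFar (⟨i, h⟩ : Fin (n-1)) ⟨j, h'⟩ := Or.inl hij
    obtain ⟨t, ht⟩ := hv
    obtain ⟨t', ht'⟩ := hv'
    have q : u * (s ⟨i, h⟩ * t) = u * (s ⟨j, h'⟩ * t') := by
      rw [← mul_assoc, ← mul_assoc, ← e, ← e', ← ht, ← ht']
    obtain ⟨y, rfl, rfl⟩ := (lcm_left (cancel_left _ q)).far hfar
    refine ⟨⟨v * s ⟨j, h'⟩, ⟨y, ?_⟩⟩, ⟨h', rfl⟩, ⟨h, ?_⟩⟩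
    · rw [ht]; simp only [mul_assoc]
    · subst e e'
      have := comm hfar 1
      simp only [mul_one] at this
      simp only [mul_assoc, this]
  d2 := by
    rintro i j ⟨u, hu⟩ ⟨v, hv⟩ ⟨v', hv'⟩ hij ⟨h, e⟩ ⟨h', e'⟩
    dsimp only at e e'
    obtain ⟨y, rfl, rfl⟩ := lcm_right_far (e.symm.trans e') (Or.inl hij)
    exact ⟨⟨y, (Dvd.intro _ rfl).trans hv⟩, ⟨h', rfl⟩, ⟨h, rfl⟩⟩
  c1 := by
    rintro i j ⟨u, hu⟩ ⟨v, hv⟩ ⟨v', hv'⟩ hij ⟨h, e⟩ ⟨h', e'⟩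
    dsimp only at e e'
    have := comm (i := (⟨i, h'⟩ : Fin (n-1))) (j := ⟨j, h⟩) (Or.inl hij) 1
    simp only [mul_one] at this
    have q : v' = u * s ⟨i, h'⟩ * s ⟨j, h⟩ := by rw [e', e, mul_assoc, ← this, mul_assoc]
    exact ⟨⟨u * s ⟨i, h'⟩, (Dvd.intro _ q.symm).trans hv'⟩, ⟨h', rfl⟩, ⟨h, q⟩⟩
  c2 := by
    rintro i j ⟨u, hu⟩ ⟨v, hv⟩ ⟨v', hv'⟩ hij ⟨h, e⟩ ⟨h', e'⟩
    dsimp only at e e'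
    have := comm (i := (⟨i, h⟩ : Fin (n-1))) (j := ⟨j, h'⟩) (Or.inl hij) 1
    simp only [mul_one] at this
    have q : v' = u * s ⟨j, h'⟩ * s ⟨i, h⟩ := by rw [e', e, mul_assoc, this, mul_assoc]
    exact ⟨⟨u * s ⟨j, h'⟩, (Dvd.intro _ q.symm).trans hv'⟩, ⟨h', rfl⟩, ⟨h, q⟩⟩
  acyc := by
    intro i u h
    have := brGr_P h
    rw [inv_mul_cancel] at this
    exact one_notMem_pos n this
  bound := fun i u v h => h.1

theorem brGr_conn {m : ℕ} (x : BrMon m) (u : {u : BrMon m // u ∣ x}) :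
    BrA (brGr x) 0 ⟨1, one_dvd x⟩ u := by
  obtain ⟨u, hu⟩ := u
  obtain ⟨l, rfl⟩ := w_surj u
  induction l using List.reverseRecOn with
  | nil => exact Relation.ReflTransGen.refl
  | append_singleton l i ih =>
    have hd : w l ∣ x := (Dvd.intro _ (w_append l [i]).symm).trans hu
    exact Relation.ReflTransGen.tail (ih hd) ⟨i, Nat.zero_le _, Or.inl ⟨i.2, w_append l [i]⟩⟩

theorem braid_tricho (n : ℕ) (g : BraidGroup n) :
    g = 1 ∨ g ∈ DehornoyPos n ∨ g⁻¹ ∈ DehornoyPos n := by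
  obtain ⟨k, b, h⟩ := braid_fraction n g
  obtain ⟨x, hx1, hx2⟩ := common (z (n-1) ^ k) b
  have := finite_dvd x
  have hg : g = (brPi n (z (n-1) ^ k))⁻¹ * brPi n b := by rw [← h, inv_mul_cancel_left]
  rcases (brGr_graph n x).tricho (n-1) 0 (by omega) ⟨_, hx1⟩ ⟨_, hx2⟩
    ((brA_symm (brGr_conn x _)).trans (brGr_conn x _)) with h | ⟨j, h | h⟩
  · left
    have h' : z (n-1) ^ k = b := congrArg Subtype.val h
    rw [hg, h', inv_mul_cancel]
  · right; left; rw [hg]; exact brGr_P h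
  · right; right; rw [hg, mul_inv_rev, inv_inv]; exact brGr_P h

theorem pos_mul (n : ℕ) {g h : BraidGroup n} (hg : g ∈ DehornoyPos n) (hh : h ∈ DehornoyPos n) :
    g * h ∈ DehornoyPos n := by
  obtain ⟨L, rfl, i, ⟨p, hp, hpi⟩, h1, h2⟩ := hg
  obtain ⟨L', rfl, i', ⟨p', hp', hpi'⟩, h1', h2'⟩ := hh
  refine ⟨L ++ L', brW_append n L L', min i i', ?_, ?_, ?_⟩
  · rcases le_total i i' with h | h
    · exact ⟨p, List.mem_append_left _ hp, by rw [min_eq_left h, hpi]⟩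
    · exact ⟨p', List.mem_append_right _ hp', by rw [min_eq_right h, hpi']⟩
  · intro q hq
    rcases List.mem_append.1 hq with hq | hq
    · exact (min_le_left _ _).trans (h1 q hq)
    · exact (min_le_right _ _).trans (h1' q hq)
  · intro q hq e
    rcases List.mem_append.1 hq with hq | hq
    · exact h2 q hq (le_antisymm (e.trans_le (min_le_left _ _)) (h1 q hq))
    · exact h2' q hq (le_antisymm (e.trans_le (min_le_right _ _)) (h1' q hq))

theorem brW_replicate (n : ℕ) (a : Fin (n-1)) (L : List (Fin (n-1) × Bool))
    (h : ∀ p ∈ L, p = (a, true)) (hL : L ≠ []) :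
    brW n L = PresentedGroup.of a ∨ brW n L * (PresentedGroup.of a)⁻¹ ∈ DehornoyPos n := by
  rcases L with _ | ⟨p, L⟩
  · exact absurd rfl hL
  obtain rfl := h p (by simp)
  rcases L with _ | ⟨q, L⟩
  · exact Or.inl rfl
  right
  have hr : (a, true) :: q :: L = (q :: L) ++ [(a, true)] := by
    have e1 : (a, true) :: q :: L = List.replicate (L.length + 2) (a, true) :=
      List.eq_replicate_iff.2 ⟨by simp, h⟩
    have e2 : (q :: L) ++ [(a, true)] = List.replicate (L.length + 2) (a, true) :=
      List.eq_replicate_iff.2 ⟨by simp, fun b hb => h b (by simp at hb ⊢; tauto)⟩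
    rw [e1, e2]
  rw [hr, brW_append, brW_pos, mul_inv_cancel_right]
  have hq := h q (by simp)
  refine ⟨q :: L, rfl, a, ⟨q, by simp, by rw [hq]⟩, ?_, ?_⟩
  · intro p hp; rw [h p (List.mem_cons_of_mem _ hp)]
  · intro p hp _; rw [h p (List.mem_cons_of_mem _ hp)]

theorem stmt17 (n : ℕ) (hn : 2 ≤ n) :
    IsRightOrder (fun g h : BraidGroup n => h * g⁻¹ ∈ DehornoyPos n) ∧
    LeastPos (fun g h : BraidGroup n => h * g⁻¹ ∈ DehornoyPos n)
      (PresentedGroup.of (rels := braidRels n) ⟨n - 2, by omega⟩) := by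
  refine ⟨⟨?_, ?_⟩, ?_, ?_⟩
  · refine { trichotomous := ?_, irrefl := ?_, trans := ?_ }
    · intro a b h1 h2
      rcases braid_tricho n (b * a⁻¹) with h | h | h
      · exact (mul_inv_eq_one.1 h).symm
      · exact absurd h h1
      · rw [mul_inv_rev, inv_inv] at h
        exact absurd h h2
    · intro a h
      rw [mul_inv_cancel] at h
      exact one_notMem_pos n h
    · intro a b c h1 h2
      have := pos_mul n h2 h1
      rwa [mul_assoc, inv_mul_cancel_left] at this
  · intro f g h hfg
    have : g * h * (f * h)⁻¹ = g * f⁻¹ := by group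
    show g * h * (f * h)⁻¹ ∈ _
    rw [this]; exact hfg
  · show _ * 1⁻¹ ∈ _
    rw [inv_one, mul_one]
    exact ⟨[(⟨n - 2, by omega⟩, true)], rfl, ⟨n - 2, by omega⟩, by simp, by simp, by simp⟩
  · intro g hg
    have hg : g * 1⁻¹ ∈ DehornoyPos n := hg
    rw [inv_one, mul_one] at hg
    have hk : n - 2 < n - 1 := by omega
    obtain ⟨L, rfl, i, ⟨p, hp, hpi⟩, h1, h2⟩ := hg
    rcases eq_or_ne i ⟨n - 2, hk⟩ with rfl | hne
    · refine brW_replicate n _ L ?_ (List.ne_nil_of_mem hp)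
      intro q hq
      have e : q.1 = ⟨n - 2, by omega⟩ := by
        have h3 := h1 q hq
        have h4 := q.1.2
        apply Fin.ext
        rw [Fin.le_def] at h3
        dsimp only at h3 ⊢
        omega
      exact Prod.ext e (h2 q hq e)
    · right
      refine ⟨L ++ [(⟨n - 2, by omega⟩, false)], ?_, i, ⟨p, by simp [hp], hpi⟩, ?_, ?_⟩
      · change brW n _ = brW n L * _
        rw [brW_append, brW_neg]
      · intro q hq
        rcases List.mem_append.1 hq with hq | hq
        · exact h1 q hq
        · simp at hq; subst hq
          have := i.2
          rw [Fin.le_def]; dsimp only; omega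
      · intro q hq e
        rcases List.mem_append.1 hq with hq | hq
        · exact h2 q hq e
        · simp at hq; subst hq
          exact absurd e.symm hne
end
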